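/- There exists a constant c > 0, depending only on n, D, and L, such that the following holds. Let (M,d) be a closed, connected metric manifold of dimension n ≥ 1 that is D-doubling and L-linearly locally contractible. Then for every x ∈ M and every 0 < r ≤ diam(M), the n-dimensional Hausdorff measure of the open ball B(x,r) satisfies H_n(B(x,r)) ≥ c · r^n. -/

import Mathlib

open Metric MeasureTheory

/-- `M` is a topological `n`-manifold: every point has an open neighborhood
homeomorphic to an open subset of `ℝⁿ`. -/
def IsTopManifold (n : ℕ) (M : Type*) [TopologicalSpace M] : Prop :=
  ∀ x : M, ∃ (U : Set M) (V : Set (EuclideanSpace ℝ (Fin n))),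
    IsOpen U ∧ x ∈ U ∧ IsOpen V ∧ Nonempty (U ≃ₜ V)

/-- `M` is `D`-doubling: every open ball `B(z,r)` contains at most `D` points that are
pairwise at distance `≥ r/2` from each other. -/
def IsDoubling (D : ℕ) (M : Type*) [MetricSpace M] : Prop :=
  ∀ (z : M) (r : ℝ) (s : Finset M), (↑s ⊆ ball z r) →
    (∀ a ∈ s, ∀ b ∈ s, a ≠ b → r / 2 ≤ dist a b) → s.card ≤ D

/-- `M` is `L`-linearly locally contractible: every ball `B(z,r)` with
`0 < r ≤ diam M / L` can be contracted to a point inside `B(z,Lr)`. -/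
def IsLLC (L : ℝ) (M : Type*) [MetricSpace M] : Prop :=
  ∀ (z : M) (r : ℝ), 0 < r → r ≤ diam (Set.univ : Set M) / L →
    ∃ h : ℝ → M → M,
      ContinuousOn (fun p : ℝ × M => h p.1 p.2) (Set.Icc 0 1 ×ˢ ball z r) ∧
      (∀ x ∈ ball z r, h 0 x = x) ∧
      (∃ c : M, ∀ x ∈ ball z r, h 1 x = c) ∧
      (∀ t ∈ Set.Icc (0:ℝ) 1, ∀ x ∈ ball z r, h t x ∈ ball z (L * r))

namespace FineChain

open Finsupp

/-- Mod 2 simplicial chains on the full simplex with vertex set `X`, augmented by the empty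
simplex. -/
abbrev Chain (X : Type*) := Finset X →₀ ZMod 2

/-- The chain consisting of a single simplex. -/
noncomputable abbrev simplex {X : Type*} (s : Finset X) : Chain X := Finsupp.single s 1

section Algebra

variable {X Y : Type*} [DecidableEq X] [DecidableEq Y]

omit [DecidableEq X] in
lemma add_self (c : Chain X) : c + c = 0 := by
  ext s; exact CharTwo.add_self_eq_zero (c s)

/-- The linear extension of a map defined on simplices. -/
noncomputable def extend (φ : Finset X → Chain Y) : Chain X →ₗ[ZMod 2] Chain Y :=
  Finsupp.linearCombination (ZMod 2) φ

omit [DecidableEq X] [DecidableEq Y] in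
@[simp] lemma extend_simplex (φ : Finset X → Chain Y) (s : Finset X) :
    extend φ (simplex s) = φ s := by
  simp [extend]

/-- The augmented mod 2 boundary operator. -/
noncomputable def bd : Chain X →ₗ[ZMod 2] Chain X :=
  extend fun s => ∑ v ∈ s, simplex (s.erase v)

/-- The cone operator with apex `v`. -/
noncomputable def cone (v : X) : Chain X →ₗ[ZMod 2] Chain X :=
  extend fun s => if v ∈ s then 0 else simplex (insert v s)

/-- The chain map induced by a map of vertices. -/
noncomputable def push (f : X → Y) : Chain X →ₗ[ZMod 2] Chain Y :=
  extend fun s => if (s.image f).card = s.card then simplex (s.image f) else 0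

lemma bd_simplex (s : Finset X) : bd (simplex s) = ∑ v ∈ s, simplex (s.erase v) :=
  extend_simplex _ _

lemma cone_simplex (v : X) (s : Finset X) :
    cone v (simplex s) = if v ∈ s then 0 else simplex (insert v s) :=
  extend_simplex _ _

omit [DecidableEq X] in
lemma push_simplex (f : X → Y) (s : Finset X) :
    push f (simplex s) = if (s.image f).card = s.card then simplex (s.image f) else 0 :=
  extend_simplex _ _

omit [DecidableEq X] in
lemma linearMap_ext {N : Type*} [AddCommMonoid N] [Module (ZMod 2) N]
    {φ ψ : Chain X →ₗ[ZMod 2] N} (h : ∀ s, φ (simplex s) = ψ (simplex s)) : φ = ψ :=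
  Finsupp.lhom_ext' fun s => LinearMap.ext_ring (h s)

@[simp] lemma bd_empty : bd (simplex (∅ : Finset X)) = 0 := by
  simp [bd_simplex]

lemma bd_cone (v : X) (c : Chain X) : bd (cone v c) = c + cone v (bd c) := by
  suffices h : bd ∘ₗ cone v = LinearMap.id + cone v ∘ₗ bd from LinearMap.congr_fun h c
  refine linearMap_ext fun s => ?_
  simp only [LinearMap.comp_apply, LinearMap.add_apply, LinearMap.id_apply, cone_simplex,
    bd_simplex, map_sum]
  by_cases hv : v ∈ s
  · rw [if_pos hv, map_zero, Finset.sum_eq_single v]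
    · rw [if_neg (Finset.notMem_erase v s), Finset.insert_erase hv, add_self]
    · intro w _ hw
      rw [if_pos (Finset.mem_erase.2 ⟨hw.symm, hv⟩)]
    · exact fun h => absurd hv h
  · rw [if_neg hv, bd_simplex, Finset.sum_insert hv, Finset.erase_insert hv]
    congr 1
    refine Finset.sum_congr rfl fun w hw => ?_
    have hne : v ≠ w := fun h => hv (h ▸ hw)
    rw [if_neg fun h => hv (Finset.mem_of_mem_erase h), Finset.erase_insert_of_ne hne]

lemma simplex_insert {v : X} {s : Finset X} (hv : v ∉ s) :
    simplex (insert v s) = cone v (simplex s) := by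
  rw [cone_simplex, if_neg hv]

lemma bd_bd (c : Chain X) : bd (bd c) = 0 := by
  suffices h : bd ∘ₗ bd = (0 : Chain X →ₗ[ZMod 2] Chain X) from LinearMap.congr_fun h c
  refine linearMap_ext fun s => ?_
  induction s using Finset.induction_on with
  | empty => simp
  | insert v s hv ih =>
    simp only [LinearMap.comp_apply, LinearMap.zero_apply] at ih ⊢
    rw [simplex_insert hv, bd_cone, map_add, bd_cone, ih, map_zero, add_zero, add_self]

lemma push_cone (f : X → Y) (v : X) (c : Chain X) :
    push f (cone v c) = cone (f v) (push f c) := by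
  suffices h : push f ∘ₗ cone v = cone (f v) ∘ₗ push f from LinearMap.congr_fun h c
  refine linearMap_ext fun s => ?_
  simp only [LinearMap.comp_apply, cone_simplex, push_simplex]
  by_cases hv : v ∈ s
  · rw [if_pos hv, map_zero]
    split_ifs
    · rw [cone_simplex, if_pos (Finset.mem_image_of_mem f hv)]
    · rw [map_zero]
  · rw [if_neg hv, push_simplex, Finset.image_insert, Finset.card_insert_of_notMem hv]
    have hle : (s.image f).card ≤ s.card := Finset.card_image_le
    by_cases hfv : f v ∈ s.image f
    · rw [Finset.insert_eq_of_mem hfv, if_neg (by omega)]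
      split_ifs
      · rw [cone_simplex, if_pos hfv]
      · rw [map_zero]
    · rw [Finset.card_insert_of_notMem hfv]
      by_cases h : (s.image f).card = s.card
      · rw [if_pos (by omega), if_pos h, cone_simplex, if_neg hfv]
      · rw [if_neg (by omega), if_neg h, map_zero]

omit [DecidableEq X] in
@[simp] lemma push_empty (f : X → Y) : push f (simplex ∅) = simplex ∅ := by
  simp [push_simplex]

lemma bd_push (f : X → Y) (c : Chain X) : bd (push f c) = push f (bd c) := by
  suffices h : bd ∘ₗ push f = push f ∘ₗ bd from LinearMap.congr_fun h c
  refine linearMap_ext fun s => ?_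
  simp only [LinearMap.comp_apply]
  induction s using Finset.induction_on with
  | empty => simp
  | insert v s hv ih =>
    rw [simplex_insert hv, push_cone, bd_cone, bd_cone, map_add, push_cone, ih]

/-- Chains supported on a family of simplices. -/
noncomputable abbrev supp (F : Set (Finset X)) : Submodule (ZMod 2) (Chain X) :=
  Finsupp.supported (ZMod 2) (ZMod 2) F

omit [DecidableEq X] in
lemma simplex_mem {F : Set (Finset X)} {s : Finset X} (h : s ∈ F) : simplex s ∈ supp F :=
  Finsupp.single_mem_supported _ _ h

omit [DecidableEq X] in
lemma map_mem {N : Type*} [AddCommGroup N] [Module (ZMod 2) N] {F : Set (Finset X)}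
    {φ : Chain X →ₗ[ZMod 2] N} {K : Submodule (ZMod 2) N}
    (h : ∀ s ∈ F, φ (simplex s) ∈ K) {c : Chain X} (hc : c ∈ supp F) : φ c ∈ K := by
  rw [supp, Finsupp.supported_eq_span_single] at hc
  have : Submodule.span (ZMod 2) ((fun i => Finsupp.single i (1 : ZMod 2)) '' F) ≤ K.comap φ := by
    rw [Submodule.span_le]
    rintro _ ⟨s, hs, rfl⟩
    exact h s hs
  exact this hc

omit [DecidableEq X] in
lemma map_eq {N : Type*} [AddCommGroup N] [Module (ZMod 2) N] {F : Set (Finset X)}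
    {φ ψ : Chain X →ₗ[ZMod 2] N}
    (h : ∀ s ∈ F, φ (simplex s) = ψ (simplex s)) {c : Chain X} (hc : c ∈ supp F) :
    φ c = ψ c := by
  have : (φ - ψ) c ∈ (⊥ : Submodule (ZMod 2) N) :=
    map_mem (fun s hs => by simp [h s hs]) hc
  simpa [sub_eq_zero] using this

omit [DecidableEq X] in
lemma apply_eq_zero {F : Set (Finset X)} {c : Chain X} (hc : c ∈ supp F) {s : Finset X}
    (hs : s ∉ F) : c s = 0 := by
  by_contra h
  exact hs (hc (Finsupp.mem_support_iff.2 h))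

omit [DecidableEq X] in
lemma mem_supp {F : Set (Finset X)} {c : Chain X} (h : ∀ s, c s ≠ 0 → s ∈ F) : c ∈ supp F :=
  fun s hs => h s (Finsupp.mem_support_iff.1 hs)

open Classical in
/-- Recursive solution of `bd (D s) = R s + D (bd s)` with `D s` in the carrier `K s`. -/
noncomputable def liftAux (S₀ : Set (Finset X)) (R D₀ : Chain X →ₗ[ZMod 2] Chain Y)
    (K : Finset X → Submodule (ZMod 2) (Chain Y)) (s : Finset X) : Chain Y :=
  if s ∈ S₀ then D₀ (simplex s) else
    if h : ∃ c ∈ K s, bd c = R (simplex s) +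
        ∑ v ∈ s.attach, liftAux S₀ R D₀ K (s.erase v.1) then h.choose else 0
termination_by s.card
decreasing_by exact Finset.card_erase_lt_of_mem v.2

/-- Acyclic carrier construction: extends a solution `D₀` of `bd D = R + D bd` from the
subcomplex `S₀` to the complex `S`. -/
theorem exists_lift {S S₀ : Set (Finset X)} (hS : ∀ s ∈ S, ∀ v ∈ s, s.erase v ∈ S)
    (hS₀ : ∀ s ∈ S₀, ∀ v ∈ s, s.erase v ∈ S₀) (R D₀ : Chain X →ₗ[ZMod 2] Chain Y)
    (hR : ∀ s ∈ S, bd (R (simplex s)) = R (bd (simplex s)))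
    (K : Finset X → Submodule (ZMod 2) (Chain Y))
    (hD₀ : ∀ s ∈ S₀, D₀ (simplex s) ∈ K s ∧
      bd (D₀ (simplex s)) = R (simplex s) + D₀ (bd (simplex s)))
    (fill : ∀ s ∈ S, s ∉ S₀ → ∀ e : X → Chain Y, (∀ v ∈ s, e v ∈ K (s.erase v)) →
      bd (R (simplex s) + ∑ v ∈ s, e v) = 0 →
      ∃ c ∈ K s, bd c = R (simplex s) + ∑ v ∈ s, e v) :
    ∃ D : Chain X →ₗ[ZMod 2] Chain Y, (∀ s ∈ S₀, D (simplex s) = D₀ (simplex s)) ∧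
      ∀ s ∈ S, D (simplex s) ∈ K s ∧ bd (D (simplex s)) = R (simplex s) + D (bd (simplex s)) := by
  have h0 : ∀ s ∈ S₀, extend (liftAux S₀ R D₀ K) (simplex s) = D₀ (simplex s) := by
    intro s hs
    rw [extend_simplex, liftAux, if_pos hs]
  refine ⟨extend (liftAux S₀ R D₀ K), h0, fun s => ?_⟩
  induction s using Finset.strongInduction with
  | H s ih =>
    intro hs
    by_cases hs0 : s ∈ S₀
    · rw [h0 s hs0]
      refine ⟨(hD₀ s hs0).1, (hD₀ s hs0).2.trans ?_⟩
      rw [bd_simplex, map_sum, map_sum]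
      congr 1
      exact Finset.sum_congr rfl fun v hv => (h0 _ (hS₀ s hs0 v hv)).symm
    · have hD : extend (liftAux S₀ R D₀ K) (bd (simplex s)) =
          ∑ v ∈ s, liftAux S₀ R D₀ K (s.erase v) := by
        rw [bd_simplex, map_sum]
        exact Finset.sum_congr rfl fun v _ => extend_simplex _ _
      have hex := fill s hs hs0 (fun v => liftAux S₀ R D₀ K (s.erase v)) (fun v hv => by
        have := (ih _ (Finset.erase_ssubset hv) (hS s hs v hv)).1
        rwa [extend_simplex] at this) (by
        rw [← hD, map_add, hR s hs]
        have h1 : bd (extend (liftAux S₀ R D₀ K) (bd (simplex s))) =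
            R (bd (simplex s)) + extend (liftAux S₀ R D₀ K) (bd (bd (simplex s))) := by
          simp only [bd_simplex s, map_sum]
          rw [← Finset.sum_add_distrib]
          refine Finset.sum_congr rfl fun v hv => ?_
          exact (ih _ (Finset.erase_ssubset hv) (hS s hs v hv)).2
        rw [h1, bd_bd, map_zero, add_zero, add_self])
      have hex' : ∃ c ∈ K s, bd c = R (simplex s) +
          ∑ v ∈ s.attach, liftAux S₀ R D₀ K (s.erase v.1) := by
        rwa [Finset.sum_attach s fun v => liftAux S₀ R D₀ K (s.erase v)]
      have hval : extend (liftAux S₀ R D₀ K) (simplex s) = hex'.choose := by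
        rw [extend_simplex, liftAux, if_neg hs0, dif_pos hex']
      refine ⟨hval ▸ hex'.choose_spec.1, ?_⟩
      rw [hval, hex'.choose_spec.2, hD,
        Finset.sum_attach s fun v => liftAux S₀ R D₀ K (s.erase v)]

lemma cone_mem {F : Set (Finset X)} {G : Set (Finset X)} {v : X}
    (h : ∀ s ∈ F, v ∉ s → insert v s ∈ G) {c : Chain X} (hc : c ∈ supp F) :
    cone v c ∈ supp G := by
  refine map_mem (fun s hs => ?_) hc
  rw [cone_simplex]
  split_ifs with hv
  · exact zero_mem _
  · exact simplex_mem (h s hs hv)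

/-- The prism operator between the chain maps induced by two vertex maps. -/
theorem exists_prism (f g : X → Y) : ∃ D : Chain X →ₗ[ZMod 2] Chain Y,
    (∀ s, D (simplex s) ∈ supp {t | t ⊆ s.image f ∪ s.image g ∧ t.card = s.card + 1}) ∧
    ∀ c, bd (D c) = push f c + push g c + D (bd c) := by
  obtain ⟨D, -, hD⟩ := exists_lift (S := Set.univ) (S₀ := {∅}) (fun _ _ _ _ => trivial)
    (by rintro s rfl v hv; simp at hv) (push f + push g) 0
    (fun s _ => by simp only [LinearMap.add_apply, map_add, bd_push])
    (fun s => supp {t | t ⊆ s.image f ∪ s.image g ∧ t.card = s.card + 1})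
    (by
      rintro s rfl
      refine ⟨by simp, ?_⟩
      simp [add_self])
    (by
      intro s _ hs e he hc
      obtain ⟨v, hv⟩ := Finset.nonempty_iff_ne_empty.2 hs
      refine ⟨cone (f v) ((push f + push g) (simplex s) + ∑ v ∈ s, e v), ?_, ?_⟩
      · refine cone_mem (F := {t | t ⊆ s.image f ∪ s.image g ∧ t.card = s.card}) ?_ ?_
        · rintro t ⟨ht, htc⟩ hvt
          refine ⟨Finset.insert_subset
            (Finset.mem_union_left _ (Finset.mem_image_of_mem f hv)) ht, ?_⟩
          rw [Finset.card_insert_of_notMem hvt, htc]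
        · refine add_mem ?_ (sum_mem fun w hw => ?_)
          · rw [LinearMap.add_apply, push_simplex, push_simplex]
            refine add_mem ?_ ?_
            · split_ifs with h
              · exact simplex_mem ⟨Finset.subset_union_left, h⟩
              · exact zero_mem _
            · split_ifs with h
              · exact simplex_mem ⟨Finset.subset_union_right, h⟩
              · exact zero_mem _
          · refine Finsupp.supported_mono ?_ (he w hw)
            rintro t ⟨ht, htc⟩
            refine ⟨ht.trans (Finset.union_subset_union
              (Finset.image_subset_image (Finset.erase_subset _ _))
              (Finset.image_subset_image (Finset.erase_subset _ _))), ?_⟩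
            rw [htc, Finset.card_erase_add_one hw]
      · rw [bd_cone, hc, map_zero, add_zero])
  refine ⟨D, fun s => (hD s trivial).1, fun c => ?_⟩
  suffices h : bd ∘ₗ D = push f + push g + D ∘ₗ bd from LinearMap.congr_fun h c
  exact linearMap_ext fun s => (hD s trivial).2

end Algebra

section MetricChains

variable {X Y : Type*} [MetricSpace X] [MetricSpace Y]

/-- The simplices with `k` vertices in `A` and of diameter at most `ε`. -/
def fine (ε : ℝ) (A : Set X) (k : ℕ) : Set (Finset X) :=
  {t | t.card = k ∧ (t : Set X) ⊆ A ∧ ∀ a ∈ t, ∀ b ∈ t, dist a b ≤ ε}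

/-- Chains of simplices with `k` vertices in `A` and of diameter at most `ε`. -/
noncomputable abbrev fineChains (ε : ℝ) (A : Set X) (k : ℕ) : Submodule (ZMod 2) (Chain X) :=
  supp (fine ε A k)

lemma fine_mono {ε ε' : ℝ} {A A' : Set X} {k : ℕ} (hε : ε ≤ ε') (hA : A ⊆ A') :
    fine ε A k ⊆ fine ε' A' k :=
  fun _ ht => ⟨ht.1, ht.2.1.trans hA, fun a ha b hb => (ht.2.2 a ha b hb).trans hε⟩

lemma fineChains_mono {ε ε' : ℝ} {A A' : Set X} {k : ℕ} (hε : ε ≤ ε') (hA : A ⊆ A') :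
    fineChains ε A k ≤ fineChains ε' A' k :=
  Finsupp.supported_mono (fine_mono hε hA)

variable [DecidableEq X] [DecidableEq Y]

lemma fine_erase {ε : ℝ} {A : Set X} {k : ℕ} {t : Finset X} (ht : t ∈ fine ε A (k + 1)) {v : X}
    (hv : v ∈ t) : t.erase v ∈ fine ε A k :=
  ⟨by rw [Finset.card_erase_of_mem hv, ht.1]; rfl,
    (Finset.coe_subset.2 (Finset.erase_subset _ _)).trans ht.2.1,
    fun a ha b hb => ht.2.2 a (Finset.mem_of_mem_erase ha) b (Finset.mem_of_mem_erase hb)⟩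

lemma bd_mem {ε : ℝ} {A : Set X} {k : ℕ} {c : Chain X} (hc : c ∈ fineChains ε A (k + 1)) :
    bd c ∈ fineChains ε A k := by
  refine map_mem (fun s hs => ?_) hc
  rw [bd_simplex]
  exact sum_mem fun v hv => simplex_mem (fine_erase hs hv)

omit [MetricSpace X] [DecidableEq X] in
lemma push_simplex_mem {ε : ℝ} {B : Set Y} {f : X → Y} {s : Finset X}
    (hB : (s.image f).card = s.card → ∀ a ∈ s, f a ∈ B)
    (hd : ∀ a ∈ s, ∀ b ∈ s, dist (f a) (f b) ≤ ε) :
    push f (simplex s) ∈ fineChains ε B s.card := by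
  rw [push_simplex]
  split_ifs with h
  · refine simplex_mem ⟨h, ?_, ?_⟩
    · intro y hy
      obtain ⟨a, ha, rfl⟩ := Finset.mem_image.1 (Finset.mem_coe.1 hy)
      exact hB h a ha
    · intro y hy y' hy'
      obtain ⟨a, ha, rfl⟩ := Finset.mem_image.1 hy
      obtain ⟨b, hb, rfl⟩ := Finset.mem_image.1 hy'
      exact hd a ha b hb
  · exact zero_mem _

omit [DecidableEq X] in
lemma push_mem {η ε : ℝ} {A : Set X} {B : Set Y} {k : ℕ} {f : X → Y} (hB : ∀ a ∈ A, f a ∈ B)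
    (hd : ∀ a ∈ A, ∀ b ∈ A, dist a b ≤ η → dist (f a) (f b) ≤ ε) {c : Chain X}
    (hc : c ∈ fineChains η A k) : push f c ∈ fineChains ε B k := by
  refine map_mem (fun s hs => ?_) hc
  rw [← hs.1]
  exact push_simplex_mem (fun _ a ha => hB a (hs.2.1 ha))
    fun a ha b hb => hd a (hs.2.1 ha) b (hs.2.1 hb) (hs.2.2 a ha b hb)

omit [MetricSpace X] in
lemma push_eq_self {F : Set (Finset X)} {f : X → X} (h : ∀ s ∈ F, ∀ a ∈ s, f a = a) {c : Chain X}
    (hc : c ∈ supp F) : push f c = c := by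
  refine map_eq (ψ := LinearMap.id) (fun s hs => ?_) hc
  have : s.image f = s := by
    rw [Finset.image_congr (g := id) fun a ha => h s hs a ha, Finset.image_id]
  rw [push_simplex, this, if_pos rfl, LinearMap.id_apply]

/-- The prism operator between two vertex maps, with control on the size of simplices. -/
theorem exists_fine_prism (f g : X → Y) : ∃ D : Chain X →ₗ[ZMod 2] Chain Y,
    (∀ c, bd (D c) = push f c + push g c + D (bd c)) ∧
    ∀ (η ε : ℝ) (A : Set X) (B : Set Y) (k : ℕ), (∀ a ∈ A, f a ∈ B) → (∀ a ∈ A, g a ∈ B) →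
      (∀ a ∈ A, ∀ b ∈ A, dist a b ≤ η → dist (f a) (f b) ≤ ε ∧ dist (f a) (g b) ≤ ε ∧
        dist (g a) (g b) ≤ ε) →
      ∀ c ∈ fineChains η A k, D c ∈ fineChains ε B (k + 1) := by
  obtain ⟨D, hD, hbd⟩ := exists_prism f g
  refine ⟨D, hbd, fun η ε A B k hf hg hd c hc => map_mem (fun s hs => ?_) hc⟩
  refine Finsupp.supported_mono ?_ (hD s)
  rintro t ⟨ht, htc⟩
  refine ⟨by rw [htc, hs.1], fun y hy => ?_, fun y hy y' hy' => ?_⟩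
  · rcases Finset.mem_union.1 (ht hy) with h | h <;> obtain ⟨a, ha, rfl⟩ := Finset.mem_image.1 h
    · exact hf a (hs.2.1 ha)
    · exact hg a (hs.2.1 ha)
  · rcases Finset.mem_union.1 (ht hy) with h | h <;> obtain ⟨a, ha, rfl⟩ := Finset.mem_image.1 h <;>
    rcases Finset.mem_union.1 (ht hy') with h' | h' <;>
    obtain ⟨b, hb, rfl⟩ := Finset.mem_image.1 h'
    · exact (hd a (hs.2.1 ha) b (hs.2.1 hb) (hs.2.2 a ha b hb)).1
    · exact (hd a (hs.2.1 ha) b (hs.2.1 hb) (hs.2.2 a ha b hb)).2.1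
    · rw [dist_comm]
      exact (hd b (hs.2.1 hb) a (hs.2.1 ha) (hs.2.2 b hb a ha)).2.1
    · exact (hd a (hs.2.1 ha) b (hs.2.1 hb) (hs.2.2 a ha b hb)).2.2

/-- `FillsAt A B η ε`: every cycle of mesh `η` in `A` bounds a chain of mesh `ε` in `B`. -/
def FillsAt (A B : Set X) (η ε : ℝ) : Prop :=
  ∀ k, ∀ z ∈ fineChains η A k, bd z = 0 → ∃ w ∈ fineChains ε B (k + 1), bd w = z

lemma FillsAt.anti {A B : Set X} {η η' ε : ℝ} (h : FillsAt A B η ε) (hη : η' ≤ η) :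
    FillsAt A B η' ε :=
  fun k z hz => h k z (fineChains_mono hη subset_rfl hz)

omit [MetricSpace X] [DecidableEq X] in
lemma sum_telescope (u : ℕ → Chain X) (N : ℕ) :
    ∑ i ∈ Finset.range N, (u i + u (i + 1)) = u 0 + u N := by
  induction N with
  | zero => simp [add_self]
  | succ N ih =>
    rw [Finset.sum_range_succ, ih]
    rw [add_assoc, ← add_assoc (u N), add_self, zero_add]

/-- A compact set which contracts inside `B` has the filling property. -/
theorem fillsAt_of_contraction {A B : Set X} (hA : IsCompact A) (h : ℝ → X → X)
    (hc : ContinuousOn (fun p : ℝ × X => h p.1 p.2) (Set.Icc 0 1 ×ˢ A))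
    (h0 : ∀ a ∈ A, h 0 a = a) {c : X} (hcB : c ∈ B) (h1 : ∀ a ∈ A, h 1 a = c)
    (hB : ∀ t ∈ Set.Icc (0 : ℝ) 1, ∀ a ∈ A, h t a ∈ B) {ε : ℝ} (hε : 0 < ε) :
    ∃ η > 0, FillsAt A B η ε := by
  have huc := (isCompact_Icc.prod hA).uniformContinuousOn_of_continuous hc
  obtain ⟨δ, hδ, hδ'⟩ := Metric.uniformContinuousOn_iff.1 huc ε hε
  have key : ∀ t ∈ Set.Icc (0 : ℝ) 1, ∀ t' ∈ Set.Icc (0 : ℝ) 1, |t - t'| < δ → ∀ a ∈ A, ∀ b ∈ A,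
      dist a b ≤ δ / 2 → dist (h t a) (h t' b) ≤ ε := by
    intro t ht t' ht' htt a ha b hb hab
    refine (hδ' (t, a) ⟨ht, ha⟩ (t', b) ⟨ht', hb⟩ ?_).le
    rw [Prod.dist_eq, max_lt_iff]
    exact ⟨by rwa [Real.dist_eq], by simp only; linarith⟩
  obtain ⟨N, hN⟩ := exists_nat_one_div_lt hδ
  refine ⟨δ / 2, by positivity, fun k z hz hbz => ?_⟩
  choose D hDb hDm using fun i : ℕ =>
    exists_fine_prism (h (i / (N + 1))) (h ((i + 1 : ℕ) / (N + 1)))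
  have ht : ∀ i ≤ N + 1, (i : ℝ) / (N + 1) ∈ Set.Icc (0 : ℝ) 1 := fun i hi => by
    have : (i : ℝ) ≤ N + 1 := by exact_mod_cast hi
    exact ⟨by positivity, by rw [div_le_one (by positivity)]; exact this⟩
  refine ⟨∑ i ∈ Finset.range (N + 1), D i z + cone c (push (h 1) z), ?_, ?_⟩
  · refine add_mem (sum_mem fun i hi => ?_) ?_
    · have hi' : i < N + 1 := Finset.mem_range.1 hi
      refine hDm i (δ / 2) ε A B k (hB _ (ht i hi'.le)) (hB _ (ht (i + 1) hi'))
        (fun a ha b hb hab => ⟨?_, ?_, ?_⟩) z hz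
      · exact key _ (ht i hi'.le) _ (ht i hi'.le) (by simpa using hδ) a ha b hb hab
      · refine key _ (ht i hi'.le) _ (ht (i + 1) hi') ?_ a ha b hb hab
        rw [abs_sub_comm, ← sub_div]
        push_cast
        rw [add_sub_cancel_left, abs_of_pos (by positivity)]
        exact hN
      · exact key _ (ht (i + 1) hi') _ (ht (i + 1) hi') (by simpa using hδ) a ha b hb hab
    · refine cone_mem (F := {t | t ⊆ {c} ∧ t.card = k}) ?_ ?_
      · rintro t ⟨htc, htk⟩ hct
        have : t = ∅ := by
          rcases Finset.subset_singleton_iff.1 htc with h | h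
          · exact h
          · exact absurd (by simp [h]) hct
        subst this
        refine ⟨by simp at htk ⊢; omega, by simpa using hcB, ?_⟩
        simp [hε.le]
      · refine map_mem (fun s hs => ?_) hz
        rw [push_simplex]
        split_ifs with hcard
        · refine simplex_mem ⟨fun y hy => ?_, by rw [hcard, hs.1]⟩
          obtain ⟨a, ha, rfl⟩ := Finset.mem_image.1 hy
          exact Finset.mem_singleton.2 (h1 a (hs.2.1 ha))
        · exact zero_mem _
  · rw [map_add, map_sum, bd_cone, bd_push, hbz, map_zero, map_zero, add_zero]
    have : ∀ i, bd (D i z) = push (h ((i : ℕ) / (N + 1))) z +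
        push (h (((i + 1 : ℕ) : ℝ) / (N + 1))) z := fun i => by
      rw [hDb, hbz, map_zero, add_zero]
    rw [Finset.sum_congr rfl fun i _ => this i,
      sum_telescope (fun i => push (h ((i : ℝ) / (N + 1))) z) (N + 1)]
    have e1 : ((N + 1 : ℕ) : ℝ) / (N + 1) = 1 := by
      push_cast; exact div_self (by positivity)
    rw [e1, add_assoc, add_self, add_zero]
    simp only [Nat.cast_zero, zero_div]
    exact push_eq_self (F := fine (δ / 2) A k) (fun s hs a ha => h0 a (hs.2.1 ha)) hz

/-- Choice of a finite increasing ladder of scales. -/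
theorem exists_ladder (Φ : ℕ → ℝ → ℝ → Prop) (hΦ : ∀ k, ∀ ε > 0, ∃ η > 0, Φ k η ε)
    (hmono : ∀ k η η' ε, η' ≤ η → Φ k η ε → Φ k η' ε) (N : ℕ) {ε : ℝ} (hε : 0 < ε) :
    ∃ e : ℕ → ℝ, (∀ k, 0 < e k) ∧ Monotone e ∧ (∀ k, e k ≤ ε) ∧
      ∀ k < N, Φ k (e k) (e (k + 1)) := by
  induction N generalizing Φ with
  | zero => exact ⟨fun _ => ε, fun _ => hε, monotone_const, fun _ => le_rfl, by simp⟩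
  | succ N ih =>
    obtain ⟨e, he, hm, hle, hs⟩ := ih (fun k => Φ (k + 1)) (fun k => hΦ (k + 1))
      (fun k => hmono (k + 1))
    obtain ⟨η, hη, hη'⟩ := hΦ 0 (e 0) (he 0)
    refine ⟨fun k => Nat.casesOn k (min η (e 0)) e, ?_, ?_, ?_, ?_⟩
    · rintro (_ | k)
      · exact lt_min hη (he 0)
      · exact he k
    · refine monotone_nat_of_le_succ ?_
      rintro (_ | k)
      · exact min_le_right _ _
      · exact hm (Nat.le_succ k)
    · rintro (_ | k)
      · exact (min_le_right _ _).trans (hle 0)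
      · exact hle k
    · rintro (_ | k) hk
      · exact hmono 0 _ _ _ (min_le_left _ _) hη'
      · exact hs k (by omega)

lemma exists_common {ι : Type*} (I : Finset ι) (Φ : ι → ℝ → Prop)
    (hmono : ∀ i η η', η' ≤ η → Φ i η → Φ i η') (h : ∀ i ∈ I, ∃ η > 0, Φ i η) :
    ∃ η > 0, ∀ i ∈ I, Φ i η := by
  classical
  induction I using Finset.induction_on with
  | empty => exact ⟨1, one_pos, by simp⟩
  | insert i I _ ih =>
    obtain ⟨η, hη, hI⟩ := ih fun j hj => h j (Finset.mem_insert_of_mem hj)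
    obtain ⟨η', hη', hi⟩ := h i (Finset.mem_insert_self i I)
    refine ⟨min η η', lt_min hη hη', fun j hj => ?_⟩
    rcases Finset.mem_insert.1 hj with rfl | hj
    · exact hmono _ _ _ (min_le_right _ _) hi
    · exact hmono _ _ _ (min_le_left _ _) (hI j hj)

end MetricChains

section Charts

/-- A closed topological `n`-simplex in `M` (parametrised by barycentric coordinates) whose
interior is open. -/
structure SChart (n : ℕ) (M : Type*) [TopologicalSpace M] where
  /-- The closed simplex. -/
  P : Set M
  /-- Barycentric coordinates. -/
  b : M → Fin (n + 1) → ℝ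
  /-- The parametrisation. -/
  g : (Fin (n + 1) → ℝ) → M
  mapsTo_b : ∀ y ∈ P, b y ∈ stdSimplex ℝ (Fin (n + 1))
  mapsTo_g : ∀ u ∈ stdSimplex ℝ (Fin (n + 1)), g u ∈ P
  g_b : ∀ y ∈ P, g (b y) = y
  b_g : ∀ u ∈ stdSimplex ℝ (Fin (n + 1)), b (g u) = u
  continuousOn_g : ContinuousOn g (stdSimplex ℝ (Fin (n + 1)))
  continuousOn_b : ContinuousOn b P
  isOpen_interior : IsOpen {y | y ∈ P ∧ ∀ i, 0 < b y i}

/-- The interior of a simplex chart. -/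
def SChart.O {n : ℕ} {M : Type*} [TopologicalSpace M] (χ : SChart n M) : Set M :=
  {y | y ∈ χ.P ∧ ∀ i, 0 < χ.b y i}

theorem exists_schart {n : ℕ} {M : Type*} [TopologicalSpace M] (hM : IsTopManifold n M) (p : M) :
    ∃ χ : SChart n M, p ∈ χ.O := by
  classical
  obtain ⟨U, V, hU, hp, hV, ⟨e⟩⟩ := hM p
  set v₀ : EuclideanSpace ℝ (Fin n) :=
    ((e ⟨p, hp⟩ : V) : EuclideanSpace ℝ (Fin n)) with hv₀
  obtain ⟨t₀, ht₀, hball⟩ := Metric.isOpen_iff.1 hV v₀ (e ⟨p, hp⟩).2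
  set A₀ : (Fin (n + 1) → ℝ) → EuclideanSpace ℝ (Fin n) :=
    fun u => WithLp.toLp 2 fun i => u i.castSucc - 1 / (n + 1) with hA₀
  have hA₀c : Continuous A₀ := by fun_prop
  obtain ⟨C, hC⟩ := ((isCompact_stdSimplex ℝ (Fin (n + 1))).image hA₀c).isBounded.exists_norm_le
  have hC' : ∀ u ∈ stdSimplex ℝ (Fin (n + 1)), ‖A₀ u‖ < |C| + 1 := fun u hu =>
    ((hC _ (Set.mem_image_of_mem _ hu)).trans (le_abs_self C)).trans_lt (lt_add_one _)
  set t := t₀ / (|C| + 1) with ht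
  have htpos : 0 < t := by positivity
  set A : (Fin (n + 1) → ℝ) → EuclideanSpace ℝ (Fin n) := fun u => v₀ + t • A₀ u with hA
  have hAc : Continuous A := by fun_prop
  have hAV : ∀ u ∈ stdSimplex ℝ (Fin (n + 1)), A u ∈ V := fun u hu => hball (by
    rw [mem_ball, dist_eq_norm, hA]
    simp only [add_sub_cancel_left, norm_smul, Real.norm_eq_abs, abs_of_pos htpos]
    calc t * ‖A₀ u‖ < t * (|C| + 1) := by gcongr; exact hC' u hu
      _ = t₀ := by rw [ht]; field_simp)
  set B₀ : EuclideanSpace ℝ (Fin n) → Fin n → ℝ :=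
    fun v i => (v i - v₀ i) / t + 1 / (n + 1) with hB₀
  set B : EuclideanSpace ℝ (Fin n) → Fin (n + 1) → ℝ :=
    fun v => Fin.snoc (α := fun _ => ℝ) (B₀ v) (1 - ∑ i, B₀ v i) with hB
  have hBc : Continuous B := by
    have h0 : Continuous B₀ := by fun_prop
    refine continuous_pi fun i => ?_
    refine Fin.lastCases ?_ (fun j => ?_) i
    · simp only [hB, Fin.snoc_last]
      fun_prop
    · simp only [hB, Fin.snoc_castSucc]
      fun_prop
  have hBs : ∀ v, ∑ i, B v i = 1 := fun v => by
    rw [Fin.sum_univ_castSucc]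
    simp [hB]
  have hBA : ∀ u ∈ stdSimplex ℝ (Fin (n + 1)), B (A u) = u := fun u hu => by
    have h0 : ∀ j, B₀ (A u) j = u j.castSucc := fun j => by
      simp only [hB₀, hA, hA₀, PiLp.add_apply, PiLp.smul_apply, smul_eq_mul]
      field_simp
      ring
    funext i
    refine Fin.lastCases ?_ (fun j => ?_) i
    · have := hu.2
      rw [Fin.sum_univ_castSucc] at this
      simp only [hB, Fin.snoc_last, h0]
      linarith
    · simp only [hB, Fin.snoc_castSucc, h0]
  have hAB : ∀ v, A (B v) = v := fun v => by
    ext j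
    simp only [hB₀, hB, hA, hA₀, PiLp.add_apply, PiLp.smul_apply, smul_eq_mul, Fin.snoc_castSucc]
    field_simp
    ring
  set b : M → Fin (n + 1) → ℝ := fun y => if hy : y ∈ U then B (e ⟨y, hy⟩ : V) else 0 with hb
  set g : (Fin (n + 1) → ℝ) → M := fun u => if hu : A u ∈ V then e.symm ⟨A u, hu⟩ else p with hg
  have hbU : ContinuousOn b U := by
    rw [continuousOn_iff_continuous_domRestrict]
    have : U.domRestrict b = fun y : U => B (e y : V) := by
      funext y
      simp [hb, Set.domRestrict_apply, y.2]
    rw [this]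
    fun_prop
  have hgs : ContinuousOn g (stdSimplex ℝ (Fin (n + 1))) := by
    rw [continuousOn_iff_continuous_domRestrict]
    have : (stdSimplex ℝ (Fin (n + 1))).domRestrict g = fun u : stdSimplex ℝ (Fin (n + 1)) =>
        ((e.symm ⟨A u.1, hAV u.1 u.2⟩ : U) : M) := by
      funext u
      simp [hg, Set.domRestrict_apply, hAV u.1 u.2]
    rw [this]
    have h1 : Continuous fun u : stdSimplex ℝ (Fin (n + 1)) => (⟨A u.1, hAV u.1 u.2⟩ : V) :=
      (hAc.comp continuous_subtype_val).subtype_mk _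
    exact continuous_subtype_val.comp (e.symm.continuous.comp h1)
  have hgU : ∀ u ∈ stdSimplex ℝ (Fin (n + 1)), g u ∈ U := fun u hu => by
    simp [hg, hAV u hu]
  have hbg : ∀ u ∈ stdSimplex ℝ (Fin (n + 1)), b (g u) = u := fun u hu => by
    simp [hg, hb, hAV u hu, hBA u hu]
  have hset : {y | y ∈ {y | y ∈ U ∧ b y ∈ stdSimplex ℝ (Fin (n + 1))} ∧ ∀ i, 0 < b y i} =
      U ∩ b ⁻¹' {u | ∀ i, 0 < u i} := by
    ext y
    constructor
    · rintro ⟨⟨h1, -⟩, h2⟩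
      exact ⟨h1, h2⟩
    · rintro ⟨h1, h2⟩
      refine ⟨⟨h1, fun i => (h2 i).le, ?_⟩, h2⟩
      simp only [hb, dif_pos h1, hBs]
  refine ⟨⟨{y | y ∈ U ∧ b y ∈ stdSimplex ℝ (Fin (n + 1))}, b, g, fun y hy => hy.2,
    fun u hu => ⟨hgU u hu, by rwa [hbg u hu]⟩, fun y hy => ?_, hbg, hgs,
    hbU.mono fun y hy => hy.1, ?_⟩, ?_⟩
  · have h1 : b y = B (e ⟨y, hy.1⟩ : V) := by simp [hb, hy.1]
    simp [h1, hg, hAB]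
  · rw [hset]
    refine hbU.isOpen_inter_preimage hU ?_
    simp only [Set.ofPred_forall]
    exact isOpen_iInter_of_finite fun i => isOpen_lt continuous_const (continuous_apply i)
  · change p ∈ {y | y ∈ {y | y ∈ U ∧ b y ∈ stdSimplex ℝ (Fin (n + 1))} ∧ ∀ i, 0 < b y i}
    rw [hset]
    refine ⟨hp, fun i => ?_⟩
    have h0 : ∀ j, B₀ v₀ j = 1 / (n + 1) := fun j => by simp [hB₀]
    have h1 : b p = B v₀ := by simp [hb, hp, hv₀]
    rw [h1]
    refine Fin.lastCases ?_ (fun j => ?_) i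
    · simp only [hB, Fin.snoc_last, h0]
      simp only [Finset.sum_const, Finset.card_univ, Fintype.card_fin, nsmul_eq_mul]
      rw [sub_pos, mul_one_div, div_lt_one (by positivity)]
      linarith
    · simp only [hB, Fin.snoc_castSucc, h0]
      positivity

end Charts

section LocalHomology

variable {n : ℕ} {M : Type*} [MetricSpace M]

lemma SChart.isCompact_P (χ : SChart n M) : IsCompact χ.P := by
  have : χ.P = χ.g '' stdSimplex ℝ (Fin (n + 1)) := by
    ext y
    constructor
    · exact fun hy => ⟨χ.b y, χ.mapsTo_b y hy, χ.g_b y hy⟩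
    · rintro ⟨u, hu, rfl⟩
      exact χ.mapsTo_g u hu
  rw [this]
  exact (isCompact_stdSimplex ℝ (Fin (n + 1))).image_of_continuousOn χ.continuousOn_g

lemma SChart.unif_g (χ : SChart n M) {ε : ℝ} (hε : 0 < ε) : ∃ κ > 0,
    ∀ u ∈ stdSimplex ℝ (Fin (n + 1)), ∀ v ∈ stdSimplex ℝ (Fin (n + 1)), dist u v ≤ κ →
      dist (χ.g u) (χ.g v) < ε := by
  obtain ⟨δ, hδ, h⟩ := Metric.uniformContinuousOn_iff.1
    ((isCompact_stdSimplex ℝ (Fin (n + 1))).uniformContinuousOn_of_continuous χ.continuousOn_g) ε hε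
  exact ⟨δ / 2, by positivity, fun u hu v hv huv => h u hu v hv (by linarith)⟩

lemma SChart.unif_b (χ : SChart n M) {ε : ℝ} (hε : 0 < ε) : ∃ δ > 0,
    ∀ y ∈ χ.P, ∀ y' ∈ χ.P, dist y y' ≤ δ → ∀ i, |χ.b y i - χ.b y' i| < ε := by
  obtain ⟨δ, hδ, h⟩ := Metric.uniformContinuousOn_iff.1
    (χ.isCompact_P.uniformContinuousOn_of_continuous χ.continuousOn_b) ε hε
  refine ⟨δ / 2, by positivity, fun y hy y' hy' hyy i => ?_⟩
  have := h y hy y' hy' (by linarith)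
  rw [← Real.dist_eq]
  exact (dist_le_pi_dist _ _ i).trans_lt this

/-- The face of the standard simplex spanned by the vertices in `L`. -/
def face (L : Finset (Fin (n + 1))) : Set (Fin (n + 1) → ℝ) :=
  {u | u ∈ stdSimplex ℝ (Fin (n + 1)) ∧ ∀ i, i ∉ L → u i = 0}

lemma face_mono {L L' : Finset (Fin (n + 1))} (h : L ⊆ L') : face L ⊆ face L' :=
  fun _ hu => ⟨hu.1, fun i hi => hu.2 i fun hL => hi (h hL)⟩

lemma isClosed_face (L : Finset (Fin (n + 1))) : IsClosed (face L) := by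
  have : face L = stdSimplex ℝ (Fin (n + 1)) ∩ ⋂ i, ⋂ (_ : i ∉ L), {u | u i = 0} := by
    ext u
    simp [face]
  rw [this]
  exact (isCompact_stdSimplex ℝ (Fin (n + 1))).isClosed.inter (isClosed_iInter fun i =>
    isClosed_iInter fun _ => isClosed_eq (continuous_apply i) continuous_const)

lemma convex_face (L : Finset (Fin (n + 1))) : Convex ℝ (face L) := by
  intro u hu v hv a b ha hb hab
  refine ⟨convex_stdSimplex ℝ _ hu.1 hv.1 ha hb hab, fun i hi => ?_⟩
  simp [hu.2 i hi, hv.2 i hi]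

lemma face_nonempty {L : Finset (Fin (n + 1))} (hL : L.Nonempty) : (face L).Nonempty := by
  obtain ⟨i, hi⟩ := hL
  refine ⟨Pi.single i 1, single_mem_stdSimplex ℝ i, fun j hj => ?_⟩
  exact Pi.single_eq_of_ne (fun h => hj (by rwa [h])) 1

variable [DecidableEq M]

lemma SChart.fillsAt_of_convex (χ : SChart n M) {Q : Set (Fin (n + 1) → ℝ)} (hQ : Convex ℝ Q)
    (hQc : IsClosed Q) (hsub : Q ⊆ stdSimplex ℝ (Fin (n + 1))) (hne : Q.Nonempty) {ε : ℝ}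
    (hε : 0 < ε) : ∃ η > 0, FillsAt (χ.g '' Q) (χ.g '' Q) η ε := by
  obtain ⟨u₀, hu₀⟩ := hne
  have hcomp : IsCompact Q := (isCompact_stdSimplex ℝ (Fin (n + 1))).of_isClosed_subset hQc hsub
  have hb : ∀ y ∈ χ.g '' Q, χ.b y ∈ Q := by
    rintro _ ⟨u, hu, rfl⟩
    rwa [χ.b_g u (hsub hu)]
  have hP : χ.g '' Q ⊆ χ.P := by
    rintro _ ⟨u, hu, rfl⟩
    exact χ.mapsTo_g u (hsub hu)
  have hmem : ∀ t ∈ Set.Icc (0 : ℝ) 1, ∀ y ∈ χ.g '' Q, (1 - t) • χ.b y + t • u₀ ∈ Q :=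
    fun t ht y hy => hQ (hb y hy) hu₀ (by linarith [ht.2]) ht.1 (by ring)
  refine fillsAt_of_contraction (hcomp.image_of_continuousOn (χ.continuousOn_g.mono hsub))
    (fun t y => χ.g ((1 - t) • χ.b y + t • u₀)) ?_ (fun y hy => ?_) (c := χ.g u₀)
    (Set.mem_image_of_mem _ hu₀) (fun y _ => by simp)
    (fun t ht y hy => Set.mem_image_of_mem _ (hmem t ht y hy)) hε
  · refine χ.continuousOn_g.comp (t := stdSimplex ℝ (Fin (n + 1))) ?_
      fun p hp => hsub (hmem p.1 hp.1 p.2 hp.2)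
    have h1 : ContinuousOn (fun p : ℝ × M => χ.b p.2) (Set.Icc 0 1 ×ˢ (χ.g '' Q)) :=
      χ.continuousOn_b.comp continuousOn_snd fun p hp => hP hp.2
    exact ((continuousOn_const.sub continuousOn_fst).smul h1).add
      (continuousOn_fst.smul continuousOn_const)
  · simp [χ.g_b y (hP hy)]

/-- `T` is a fine subdivision of the simplex chart `χ`: a chain map from the simplicial chains
of the simplex, carried by faces. -/
def SChart.IsSubdiv (χ : SChart n M) (η : ℝ)
    (T : Chain (Fin (n + 1)) →ₗ[ZMod 2] Chain M) : Prop :=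
  T (simplex ∅) = simplex ∅ ∧ ∀ L, T (simplex L) ∈ fineChains η (χ.g '' face L) L.card ∧
    bd (T (simplex L)) = T (bd (simplex L))

lemma SChart.IsSubdiv.bd_eq {χ : SChart n M} {η : ℝ}
    {T : Chain (Fin (n + 1)) →ₗ[ZMod 2] Chain M} (hT : χ.IsSubdiv η T)
    (c : Chain (Fin (n + 1))) : bd (T c) = T (bd c) := by
  suffices h : bd ∘ₗ T = T ∘ₗ bd from LinearMap.congr_fun h c
  exact linearMap_ext fun s => (hT.2 s).2

theorem SChart.exists_isSubdiv (χ : SChart n M) {ε : ℝ} (hε : 0 < ε) :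
    ∃ T, χ.IsSubdiv ε T := by
  obtain ⟨e, -, hmono, hle, hstep⟩ := exists_ladder
    (fun _ η ε => ∀ L ∈ (Finset.univ.filter Finset.Nonempty : Finset (Finset (Fin (n + 1)))),
      FillsAt (χ.g '' face L) (χ.g '' face L) η ε)
    (fun _ ε hε => exists_common _ _ (fun L η η' h hf => hf.anti h) fun L hL =>
      χ.fillsAt_of_convex (convex_face L) (isClosed_face L) (fun u hu => hu.1)
        (face_nonempty (Finset.mem_filter.1 hL).2) hε)
    (fun _ η η' ε h hf L hL => (hf L hL).anti h) (n + 1) hε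
  obtain ⟨T, hT0, hT⟩ := exists_lift (X := Fin (n + 1)) (Y := M) (S := Set.univ) (S₀ := {∅})
    (fun _ _ _ _ => trivial)
    (by rintro s rfl v hv; simp at hv) 0 (extend fun _ => simplex ∅)
    (fun s _ => by simp)
    (fun s => fineChains (e s.card) (χ.g '' face s) s.card)
    (by
      rintro s rfl
      rw [extend_simplex, bd_empty, bd_empty, map_zero]
      exact ⟨simplex_mem ⟨rfl, by simp, by simp⟩, by simp⟩)
    (by
      intro s _ hs c hc hbd
      have hs' : s.Nonempty := Finset.nonempty_iff_ne_empty.2 hs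
      obtain ⟨k, hk⟩ : ∃ k, s.card = k + 1 := ⟨s.card - 1, by have := hs'.card_pos; omega⟩
      have hkn : k < n + 1 := by
        have := s.card_le_univ
        simp at this
        omega
      rw [LinearMap.zero_apply, zero_add] at hbd ⊢
      rw [hk]
      refine hstep k hkn s (by simp [hs']) k _ (sum_mem fun v hv => ?_) hbd
      have := hc v hv
      rw [Finset.card_erase_of_mem hv, hk, Nat.add_sub_cancel] at this
      exact fineChains_mono le_rfl (Set.image_mono (face_mono (Finset.erase_subset _ _))) this)
  refine ⟨T, by rw [hT0 ∅ rfl, extend_simplex], fun L => ⟨?_, ?_⟩⟩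
  · exact fineChains_mono (hle _) subset_rfl (hT L trivial).1
  · rw [(hT L trivial).2, LinearMap.zero_apply, zero_add]

/-- A Sperner labelling adapted to the point `q`. -/
noncomputable def SChart.lab (χ : SChart n M) (q y : M) : Fin (n + 1) :=
  if h : ∃ i, χ.b q i ≤ χ.b y i then h.choose else 0

omit [DecidableEq M] in
lemma SChart.lab_spec (χ : SChart n M) {q y : M} (hq : q ∈ χ.P) (hy : y ∈ χ.P) :
    χ.b q (χ.lab q y) ≤ χ.b y (χ.lab q y) := by
  have h : ∃ i, χ.b q i ≤ χ.b y i := by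
    by_contra! h
    have := Finset.sum_lt_sum_of_nonempty Finset.univ_nonempty fun i (_ : i ∈ Finset.univ) => h i
    rw [(χ.mapsTo_b q hq).2, (χ.mapsTo_b y hy).2] at this
    exact lt_irrefl _ this
  rw [SChart.lab, dif_pos h]
  exact h.choose_spec

open Classical in
/-- The local degree at `q` of a fine `n`-chain: the number mod 2 of fully labelled simplices. -/
noncomputable def SChart.deg (χ : SChart n M) (q : M) : Chain M →ₗ[ZMod 2] ZMod 2 :=
  Finsupp.linearCombination (ZMod 2) fun s =>
    if (s : Set M) ⊆ χ.P ∧ s.image (χ.lab q) = Finset.univ ∧ s.card = n + 1 then 1 else 0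

omit [DecidableEq M] in
lemma SChart.deg_simplex_eq_zero (χ : SChart n M) {q : M} {s : Finset M}
    (h : ¬((s : Set M) ⊆ χ.P ∧ s.image (χ.lab q) = Finset.univ)) : χ.deg q (simplex s) = 0 := by
  rw [SChart.deg, Finsupp.linearCombination_single, one_smul,
    if_neg fun h' => h ⟨h'.1, h'.2.1⟩]

omit [DecidableEq M] in
lemma SChart.deg_eq_push (χ : SChart n M) (q : M) {z : Chain M}
    (hz : z ∈ supp {s | (s : Set M) ⊆ χ.P ∧ s.card = n + 1}) :
    χ.deg q z = push (χ.lab q) z Finset.univ := by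
  refine map_eq (φ := χ.deg q) (ψ := Finsupp.lapply Finset.univ ∘ₗ push (χ.lab q))
    (fun s hs => ?_) hz
  rw [SChart.deg, Finsupp.linearCombination_single, one_smul, LinearMap.comp_apply, push_simplex,
    Finsupp.lapply_apply]
  by_cases h : s.image (χ.lab q) = Finset.univ
  · have hc : (s.image (χ.lab q)).card = s.card := by rw [h, hs.2]; simp
    rw [if_pos hc, if_pos ⟨hs.1, h, hs.2⟩, h, Finsupp.single_eq_same]
  · rw [if_neg fun h' => h h'.2.1]
    split_ifs
    · rw [Finsupp.single_eq_of_ne' h]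
    · rfl

omit [DecidableEq M] in
lemma SChart.exists_labelled_near (χ : SChart n M) {q : M} (hq : q ∈ χ.P) {ρ : ℝ}
    (hρ : 0 < ρ) : ∃ ε > 0, ∀ s : Finset M, (s : Set M) ⊆ χ.P →
      (∀ a ∈ s, ∀ b ∈ s, dist a b ≤ ε) → s.image (χ.lab q) = Finset.univ →
      (s : Set M) ⊆ ball q ρ := by
  obtain ⟨κ, hκ, hκ'⟩ := χ.unif_g hρ
  obtain ⟨δ, hδ, hδ'⟩ := χ.unif_b (ε := κ / (n + 1)) (by positivity)
  refine ⟨δ, hδ, fun s hs hf himg y hy => ?_⟩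
  have hyP := hs hy
  have hlow : ∀ i, χ.b q i - κ / (n + 1) ≤ χ.b y i := fun i => by
    have hi : i ∈ s.image (χ.lab q) := himg ▸ Finset.mem_univ i
    obtain ⟨a, ha, rfl⟩ := Finset.mem_image.1 hi
    have h1 := χ.lab_spec hq (hs ha)
    have h2 := abs_lt.1 (hδ' a (hs ha) y hyP (hf a ha y hy) (χ.lab q a))
    linarith [h2.2]
  rw [mem_ball, ← χ.g_b y hyP, ← χ.g_b q hq]
  refine hκ' _ (χ.mapsTo_b y hyP) _ (χ.mapsTo_b q hq) ((dist_pi_le_iff hκ.le).2 fun i => ?_)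
  rw [Real.dist_eq, abs_le]
  have hle : κ / (n + 1) ≤ κ := div_le_self hκ.le (by linarith [n.cast_nonneg (α := ℝ)])
  refine ⟨by linarith [hlow i], ?_⟩
  have hsum := Finset.sum_le_sum fun j (_ : j ∈ Finset.univ.erase i) => hlow j
  have h1 := Finset.add_sum_erase Finset.univ (χ.b y) (Finset.mem_univ i)
  have h2 := Finset.add_sum_erase Finset.univ (χ.b q) (Finset.mem_univ i)
  rw [(χ.mapsTo_b y hyP).2] at h1
  rw [(χ.mapsTo_b q hq).2] at h2
  rw [Finset.sum_sub_distrib, Finset.sum_const, Finset.card_erase_of_mem (Finset.mem_univ i),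
    Finset.card_univ, Fintype.card_fin, Nat.add_sub_cancel, nsmul_eq_mul] at hsum
  have h3 : (n : ℝ) * (κ / (n + 1)) ≤ κ := by
    rw [mul_div_assoc', div_le_iff₀ (by positivity)]
    nlinarith
  linarith

theorem SChart.exists_deg_bd (χ : SChart n M) {q : M} (hq : q ∈ χ.O) {ρ : ℝ} (hρ : 0 < ρ) :
    ∃ ε > 0, (∀ w ∈ fineChains ε Set.univ (n + 2), χ.deg q (bd w) = 0) ∧
      ∀ y ∈ fineChains ε (ball q ρ)ᶜ (n + 1), χ.deg q y = 0 := by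
  obtain ⟨r, hr, hball⟩ := Metric.isOpen_iff.1 χ.isOpen_interior q hq
  obtain ⟨ε, hε, hnear⟩ := χ.exists_labelled_near hq.1 (lt_min hρ (half_pos hr))
  refine ⟨min ε (r / 2), lt_min hε (half_pos hr), fun w hw => ?_, fun y hy => ?_⟩
  · refine map_mem (φ := χ.deg q ∘ₗ bd) (K := ⊥) (fun t ht => ?_) hw
    rw [LinearMap.comp_apply, Submodule.mem_bot]
    have hsub : ∀ v ∈ t, ∀ a ∈ t.erase v, ∀ b ∈ t.erase v, dist a b ≤ ε := fun v hv a ha b hb =>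
      (ht.2.2 a (Finset.mem_of_mem_erase ha) b (Finset.mem_of_mem_erase hb)).trans (min_le_left _ _)
    by_cases hex : ∃ v ∈ t, ((t.erase v : Finset M) : Set M) ⊆ χ.P ∧
        (t.erase v).image (χ.lab q) = Finset.univ
    · obtain ⟨v, hv, hP, himg⟩ := hex
      have hn := hnear _ hP (hsub v hv) himg
      obtain ⟨a, ha⟩ : (t.erase v).Nonempty := by
        rw [← Finset.card_pos, Finset.card_erase_of_mem hv, ht.1]
        omega
      have htP : (t : Set M) ⊆ χ.P := fun y hy => (hball (by
        have h1 := hn ha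
        rw [mem_ball] at h1 ⊢
        have h2 := (ht.2.2 y hy a (Finset.mem_of_mem_erase ha)).trans (min_le_right _ _)
        have h3 := h1.trans_le (min_le_right _ _)
        linarith [dist_triangle y a q])).1
      rw [χ.deg_eq_push, ← bd_push, push_simplex, if_neg, map_zero, Finsupp.coe_zero,
        Pi.zero_apply]
      · have := (t.image (χ.lab q)).card_le_univ
        rw [Fintype.card_fin] at this
        rw [ht.1]
        omega
      · rw [bd_simplex]
        refine sum_mem fun v hv => simplex_mem ⟨fun y hy => htP (Finset.mem_of_mem_erase hy), ?_⟩
        rw [Finset.card_erase_of_mem hv, ht.1]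
        omega
    · push Not at hex
      rw [bd_simplex, map_sum]
      exact Finset.sum_eq_zero fun v hv => χ.deg_simplex_eq_zero fun h => hex v hv h.1 h.2
  · refine map_mem (φ := χ.deg q) (K := ⊥) (fun s hs => ?_) hy
    refine χ.deg_simplex_eq_zero fun h => ?_
    obtain ⟨a, ha⟩ : s.Nonempty := by rw [← Finset.card_pos, hs.1]; omega
    refine hs.2.1 ha (ball_subset_ball (min_le_left _ _) (hnear s h.1 (fun a ha b hb =>
      (hs.2.2 a ha b hb).trans (min_le_left _ _)) h.2 ha))

omit [MetricSpace M] [DecidableEq M] in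
lemma eq_smul_of_mem_supp_singleton {L : Finset M} {c : Chain M} (hc : c ∈ supp {L}) :
    c = c L • simplex L := by
  ext s
  by_cases h : s = L
  · subst h
    simp
  · rw [apply_eq_zero hc h]
    simp [Finsupp.single_eq_of_ne h]

lemma SChart.push_subdiv (χ : SChart n M) {q : M} (hq : q ∈ χ.O) {η : ℝ}
    {T : Chain (Fin (n + 1)) →ₗ[ZMod 2] Chain M} (hT : χ.IsSubdiv η T)
    (L : Finset (Fin (n + 1))) : push (χ.lab q) (T (simplex L)) = simplex L := by
  induction L using Finset.strongInduction with
  | H L ih =>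
    rcases L.eq_empty_or_nonempty with rfl | ⟨v, hv⟩
    · rw [hT.1, push_empty]
    have hmem : push (χ.lab q) (T (simplex L)) ∈ supp {L} := by
      refine map_mem (fun s hs => ?_) (hT.2 L).1
      rw [push_simplex]
      split_ifs with hc
      · refine simplex_mem (Finset.eq_of_subset_of_card_le (fun i hi => ?_) (by rw [hc, hs.1]))
        obtain ⟨a, ha, rfl⟩ := Finset.mem_image.1 hi
        obtain ⟨u, hu, rfl⟩ := hs.2.1 ha
        by_contra hL
        have h1 := χ.lab_spec hq.1 (χ.mapsTo_g u hu.1)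
        rw [χ.b_g u hu.1, hu.2 _ hL] at h1
        exact absurd (hq.2 _) (not_lt.2 h1)
      · exact zero_mem _
    have hbd : bd (push (χ.lab q) (T (simplex L))) = bd (simplex L) := by
      rw [bd_push, (hT.2 L).2, bd_simplex, map_sum, map_sum]
      exact Finset.sum_congr rfl fun w hw => ih _ (Finset.erase_ssubset hw)
    have heq := eq_smul_of_mem_supp_singleton hmem
    rcases (by decide : ∀ c : ZMod 2, c = 0 ∨ c = 1) (push (χ.lab q) (T (simplex L)) L) with h | h
    · rw [h, zero_smul] at heq
      rw [heq, map_zero, bd_simplex] at hbd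
      have h2 := DFunLike.congr_fun hbd (L.erase v)
      rw [Finsupp.finsetSum_apply, Finset.sum_eq_single v] at h2
      · simp at h2
      · intro w hw hwv
        refine Finsupp.single_eq_of_ne fun h => hwv ?_
        by_contra _
        have : w ∈ L.erase v := Finset.mem_erase.2 ⟨hwv, hw⟩
        rw [h] at this
        exact Finset.notMem_erase w L this
      · exact fun h => absurd hv h
    · rw [h, one_smul] at heq
      exact heq

lemma SChart.IsSubdiv.top_mem {χ : SChart n M} {η : ℝ}
    {T : Chain (Fin (n + 1)) →ₗ[ZMod 2] Chain M} (hT : χ.IsSubdiv η T) :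
    T (simplex Finset.univ) ∈ fineChains η χ.P (n + 1) := by
  have := (hT.2 Finset.univ).1
  rw [Finset.card_univ, Fintype.card_fin] at this
  refine fineChains_mono le_rfl ?_ this
  rintro _ ⟨u, hu, rfl⟩
  exact χ.mapsTo_g u hu.1

lemma SChart.IsSubdiv.bd_top_mem {χ : SChart n M} {η : ℝ}
    {T : Chain (Fin (n + 1)) →ₗ[ZMod 2] Chain M} (hT : χ.IsSubdiv η T) :
    bd (T (simplex Finset.univ)) ∈ fineChains η χ.Oᶜ n := by
  rw [hT.bd_eq, bd_simplex, map_sum]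
  refine sum_mem fun v hv => ?_
  have := (hT.2 (Finset.univ.erase v)).1
  rw [Finset.card_erase_of_mem hv, Finset.card_univ, Fintype.card_fin, Nat.add_sub_cancel] at this
  refine fineChains_mono le_rfl ?_ this
  rintro _ ⟨u, hu, rfl⟩ hO
  have h := hO.2 v
  rw [χ.b_g u hu.1, hu.2 v (Finset.notMem_erase v _)] at h
  exact lt_irrefl _ h

lemma SChart.IsSubdiv.deg_top {χ : SChart n M} {η : ℝ}
    {T : Chain (Fin (n + 1)) →ₗ[ZMod 2] Chain M} (hT : χ.IsSubdiv η T) {q : M} (hq : q ∈ χ.O) :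
    χ.deg q (T (simplex Finset.univ)) = 1 := by
  have hsub : fine η χ.P (n + 1) ⊆ {s | (s : Set M) ⊆ χ.P ∧ s.card = n + 1} :=
    fun s hs => ⟨hs.2.1, hs.1⟩
  rw [χ.deg_eq_push q (Finsupp.supported_mono hsub hT.top_mem), χ.push_subdiv hq hT, Finsupp.single_eq_same]

end LocalHomology

section LocalHomology

variable {n : ℕ} {M : Type*} [MetricSpace M]

lemma SChart.lt_b_of_ball_subset (χ : SChart n M) (hn : 1 ≤ n) {κ ρ : ℝ}
    (hκ : ∀ u ∈ stdSimplex ℝ (Fin (n + 1)), ∀ v ∈ stdSimplex ℝ (Fin (n + 1)), dist u v ≤ κ →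
      dist (χ.g u) (χ.g v) < ρ) (hρ : 0 < ρ) {q : M} (hq : ball q ρ ⊆ χ.O) (j : Fin (n + 1)) :
    κ < χ.b q j := by
  by_contra! hlt
  have hqO := hq (mem_ball_self hρ)
  have hqs := χ.mapsTo_b q hqO.1
  obtain ⟨k, hk⟩ : ∃ k, k ≠ j := by
    have : Nontrivial (Fin (n + 1)) := Fin.nontrivial_iff_two_le.2 (by omega)
    exact exists_ne j
  set t := χ.b q j with ht
  set u : Fin (n + 1) → ℝ := χ.b q + t • (Pi.single k 1 - Pi.single j 1) with hu
  have huj : u j = 0 := by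
    simp [hu, Pi.single_eq_of_ne hk.symm, ht]
  have hus : u ∈ stdSimplex ℝ (Fin (n + 1)) := by
    refine ⟨fun i => ?_, ?_⟩
    · by_cases hij : i = j
      · rw [hij, huj]
      · have h1 := hqs.1 i
        have h2 : (0 : ℝ) ≤ (Pi.single k 1 : Fin (n + 1) → ℝ) i := by
          by_cases hik : i = k
          · subst hik; simp
          · simp [Pi.single_eq_of_ne hik]
        have h3 := mul_nonneg (hqs.1 j) h2
        simp only [hu, Pi.add_apply, Pi.smul_apply, Pi.sub_apply, Pi.single_eq_of_ne hij,
          smul_eq_mul, sub_zero]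
        linarith
    · simp [hu, Finset.sum_add_distrib, ← Finset.mul_sum, hqs.2]
  have hdist : dist u (χ.b q) ≤ κ := by
    have hκ0 : 0 ≤ κ := (hqs.1 j).trans hlt
    refine (dist_pi_le_iff hκ0).2 fun i => ?_
    have h1 : |(Pi.single k 1 - Pi.single j 1 : Fin (n + 1) → ℝ) i| ≤ 1 := by
      by_cases hij : i = j
      · subst hij
        simp [Pi.single_eq_of_ne hk.symm]
      · by_cases hik : i = k
        · subst hik
          simp [Pi.single_eq_of_ne hk]
        · simp [Pi.single_eq_of_ne hij, Pi.single_eq_of_ne hik]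
    rw [Real.dist_eq, hu, Pi.add_apply, add_sub_cancel_left, Pi.smul_apply, smul_eq_mul, abs_mul,
      abs_of_nonneg (hqs.1 j)]
    calc χ.b q j * _ ≤ χ.b q j * 1 := mul_le_mul_of_nonneg_left h1 (hqs.1 j)
      _ ≤ κ := by rwa [mul_one]
  have h1 := hκ u hus _ hqs hdist
  rw [χ.g_b q hqO.1] at h1
  have h2 := (hq (mem_ball.2 h1)).2 j
  rw [χ.b_g u hus, huj] at h2
  exact lt_irrefl _ h2

lemma SChart.exists_b_le (χ : SChart n M) {κ ρ : ℝ} (hκ0 : 0 < κ)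
    (hκ : ∀ u ∈ stdSimplex ℝ (Fin (n + 1)), ∀ v ∈ stdSimplex ℝ (Fin (n + 1)), dist u v ≤ κ →
      dist (χ.g u) (χ.g v) < ρ) {q y : M} (hq : q ∈ χ.P) (hy : y ∈ χ.P) (hd : ρ ≤ dist y q) :
    ∃ j, χ.b y j ≤ χ.b q j - κ / (n + 1) := by
  by_contra! h
  refine absurd hd (not_le.2 ?_)
  rw [← χ.g_b y hy, ← χ.g_b q hq]
  have hlow := fun i => (h i).le
  refine hκ _ (χ.mapsTo_b y hy) _ (χ.mapsTo_b q hq) ((dist_pi_le_iff hκ0.le).2 fun i => ?_)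
  rw [Real.dist_eq, abs_le]
  have hle : κ / (n + 1) ≤ κ := div_le_self hκ0.le (by linarith [n.cast_nonneg (α := ℝ)])
  refine ⟨by linarith [hlow i], ?_⟩
  have hsum := Finset.sum_le_sum fun j (_ : j ∈ Finset.univ.erase i) => hlow j
  have h1 := Finset.add_sum_erase Finset.univ (χ.b y) (Finset.mem_univ i)
  have h2 := Finset.add_sum_erase Finset.univ (χ.b q) (Finset.mem_univ i)
  rw [(χ.mapsTo_b y hy).2] at h1
  rw [(χ.mapsTo_b q hq).2] at h2
  rw [Finset.sum_sub_distrib, Finset.sum_const, Finset.card_erase_of_mem (Finset.mem_univ i),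
    Finset.card_univ, Fintype.card_fin, Nat.add_sub_cancel, nsmul_eq_mul] at hsum
  have h3 : (n : ℝ) * (κ / (n + 1)) ≤ κ := by
    rw [mul_div_assoc', div_le_iff₀ (by positivity)]
    nlinarith
  linarith

/-- The part of the standard simplex cut out by upper bounds on some coordinates. -/
def cut (β : Fin (n + 1) → ℝ) (J : Set (Fin (n + 1))) : Set (Fin (n + 1) → ℝ) :=
  {u | u ∈ stdSimplex ℝ (Fin (n + 1)) ∧ ∀ j ∈ J, u j ≤ β j}

lemma isClosed_cut (β : Fin (n + 1) → ℝ) (J : Set (Fin (n + 1))) : IsClosed (cut β J) := by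
  have : cut β J = stdSimplex ℝ (Fin (n + 1)) ∩ ⋂ j ∈ J, {u | u j ≤ β j} := by
    ext u
    simp [cut]
  rw [this]
  exact (isCompact_stdSimplex ℝ (Fin (n + 1))).isClosed.inter (isClosed_iInter fun i =>
    isClosed_iInter fun _ => isClosed_le (continuous_apply i) continuous_const)

lemma convex_cut (β : Fin (n + 1) → ℝ) (J : Set (Fin (n + 1))) : Convex ℝ (cut β J) := by
  intro u hu v hv a b ha hb hab
  refine ⟨convex_stdSimplex ℝ _ hu.1 hv.1 ha hb hab, fun j hj => ?_⟩
  calc a * u j + b * v j ≤ a * β j + b * β j :=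
        add_le_add (mul_le_mul_of_nonneg_left (hu.2 j hj) ha)
          (mul_le_mul_of_nonneg_left (hv.2 j hj) hb)
    _ = β j := by rw [← add_mul, hab, one_mul]

lemma cut_anti (β : Fin (n + 1) → ℝ) {J J' : Set (Fin (n + 1))} (h : J ⊆ J') :
    cut β J' ⊆ cut β J :=
  fun _ hu => ⟨hu.1, fun j hj => hu.2 j (h hj)⟩

variable [DecidableEq M]

/-- On fine chains in the chart, the composite of labelling and subdivision is homotopic to the
identity, through chains respecting the half spaces `b y j ≤ β j`. -/
theorem SChart.exists_label_homotopy (χ : SChart n M) {q : M} (hq : q ∈ χ.P)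
    {β : Fin (n + 1) → ℝ} (hβ : ∀ j, 0 ≤ β j) (hβq : ∀ j, β j < χ.b q j) {ε : ℝ} (hε : 0 < ε) :
    ∃ η > 0, ∀ T, χ.IsSubdiv η T → ∃ D : Chain M →ₗ[ZMod 2] Chain M,
      ∀ k ≤ n + 1, ∀ s ∈ fine η χ.P k,
        D (simplex s) ∈ fineChains ε (χ.g '' cut β {j | ∀ a ∈ s, χ.b a j ≤ β j}) (k + 1) ∧
        bd (D (simplex s)) = simplex s + T (push (χ.lab q) (simplex s)) + D (bd (simplex s)) := by
  obtain ⟨e, hpos, hmono, hle, hstep⟩ := exists_ladder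
    (fun _ η ε => ∀ J ∈ (Set.toFinite {J : Set (Fin (n + 1)) | (cut β J).Nonempty}).toFinset,
      FillsAt (χ.g '' cut β J) (χ.g '' cut β J) η ε)
    (fun _ ε hε => exists_common _ _ (fun J η η' h hf => hf.anti h) fun J hJ =>
      χ.fillsAt_of_convex (convex_cut β J) (isClosed_cut β J) (fun u hu => hu.1)
        (by simpa using hJ) hε)
    (fun _ η η' ε h hf J hJ => (hf J hJ).anti h) (n + 2) hε
  refine ⟨e 0, hpos 0, fun T hT => ?_⟩
  set J : Finset M → Set (Fin (n + 1)) := fun s => {j | ∀ a ∈ s, χ.b a j ≤ β j} with hJ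
  have hJmono : ∀ s t : Finset M, s ⊆ t → cut β (J s) ⊆ cut β (J t) := fun s t h =>
    cut_anti β fun j hj a ha => hj a (h ha)
  have hself : ∀ s : Finset M, (s : Set M) ⊆ χ.P → (s : Set M) ⊆ χ.g '' cut β (J s) :=
    fun s hs a ha => ⟨χ.b a, ⟨χ.mapsTo_b a (hs ha), fun j hj => hj a ha⟩, χ.g_b a (hs ha)⟩
  obtain ⟨D, -, hD⟩ := exists_lift (X := M) (Y := M)
    (S := {s | ∃ k ≤ n + 1, s ∈ fine (e 0) χ.P k}) (S₀ := {∅})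
    (by
      rintro s ⟨k, hk, hs⟩ v hv
      obtain ⟨k, rfl⟩ : ∃ l, k = l + 1 := ⟨k - 1, by
        have := Finset.card_pos.2 ⟨v, hv⟩
        rw [hs.1] at this
        omega⟩
      exact ⟨k, by omega, fine_erase hs hv⟩)
    (by rintro s rfl v hv; simp at hv) (LinearMap.id + T ∘ₗ push (χ.lab q)) 0
    (fun _ _ => by
      simp only [LinearMap.add_apply, LinearMap.id_apply, LinearMap.comp_apply, map_add,
        hT.bd_eq, bd_push])
    (fun s => fineChains (e s.card) (χ.g '' cut β (J s)) (s.card + 1))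
    (by
      rintro s rfl
      simp [hT.1, add_self])
    (by
      rintro s ⟨l, hl, hs⟩ hs0 c hc hbd
      have hs' : s.Nonempty := Finset.nonempty_iff_ne_empty.2 hs0
      obtain ⟨k, hk⟩ : ∃ k, s.card = k + 1 := ⟨s.card - 1, by have := hs'.card_pos; omega⟩
      have hkn : k < n + 2 := by
        have := hs.1
        omega
      obtain ⟨a₀, ha₀⟩ := hs'
      obtain ⟨u₀, hu₀, -⟩ := hself s hs.2.1 ha₀
      rw [hk]
      refine hstep k hkn (J s) (by simpa using ⟨u₀, hu₀⟩) (k + 1) _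
        (add_mem (add_mem ?_ ?_) (sum_mem fun v hv => ?_)) hbd
      · exact simplex_mem ⟨hk, hself s hs.2.1, fun a ha b hb =>
          (hs.2.2 a ha b hb).trans (hmono (Nat.zero_le k))⟩
      · rw [LinearMap.comp_apply, push_simplex]
        split_ifs with hcard
        · have := (hT.2 (s.image (χ.lab q))).1
          rw [hcard, hk] at this
          refine fineChains_mono (hmono (Nat.zero_le k)) (Set.image_mono ?_) this
          refine fun u hu => ⟨hu.1, fun j hj => ?_⟩
          rw [hu.2 j]
          · exact hβ j
          · intro hjs
            obtain ⟨a, ha, rfl⟩ := Finset.mem_image.1 hjs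
            have h1 := χ.lab_spec hq (hs.2.1 ha)
            have h2 := hj a ha
            linarith [hβq (χ.lab q a)]
        · rw [map_zero]
          exact zero_mem _
      · have := hc v hv
        rw [Finset.card_erase_of_mem hv, hk, Nat.add_sub_cancel] at this
        exact fineChains_mono le_rfl (Set.image_mono (hJmono _ _ (Finset.erase_subset _ _))) this)
  refine ⟨D, fun k hk s hs => ?_⟩
  have := hD s ⟨k, hk, hs⟩
  rw [hs.1] at this
  exact ⟨fineChains_mono (hle _) subset_rfl this.1, this.2⟩

omit [DecidableEq M] in
lemma inf_fine {η : ℝ} {A B : Set M} {k : ℕ} {c : Chain M} (h : c ∈ fineChains η A k)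
    (h' : c ∈ fineChains η B k) : c ∈ fineChains η (A ∩ B) k :=
  fun _ hs => ⟨(h hs).1, Set.subset_inter (h hs).2.1 (h' hs).2.1, (h hs).2.2⟩

/-- The local homology of the manifold at an interior point of a chart is generated by the
simplex of the chart. -/
theorem SChart.local_homology (χ : SChart n M) (hn : 1 ≤ n) {ρ : ℝ} (hρ : 0 < ρ) :
    ∃ ρ' > 0, ∀ q, ball q ρ ⊆ χ.O → ∀ ε > 0, ∃ η > 0, ∀ T, χ.IsSubdiv η T →
      ∀ z ∈ fineChains η Set.univ (n + 1), bd z ∈ fineChains η (ball q ρ)ᶜ n →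
      ∃ w ∈ fineChains ε Set.univ (n + 2),
        z + χ.deg q z • T (simplex Finset.univ) + bd w ∈ fineChains ε (ball q ρ')ᶜ (n + 1) := by
  classical
  obtain ⟨κ₀, hκ₀, hg⟩ := χ.unif_g (half_pos hρ)
  set κ := κ₀ / (n + 1) / 2 with hκ
  have hκpos : 0 < κ := by positivity
  have hκle : κ ≤ κ₀ := by
    rw [hκ, div_div]
    exact div_le_self hκ₀.le (by linarith [n.cast_nonneg (α := ℝ)])
  obtain ⟨δ, hδ, hb⟩ := χ.unif_b hκpos
  have hρ2 : ρ / 2 ≤ ρ := by linarith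
  refine ⟨min δ (ρ / 2), by positivity, fun q hq ε hε => ?_⟩
  have hqP : q ∈ χ.P := (hq (mem_ball_self hρ)).1
  have hqκ : ∀ j, κ₀ < χ.b q j := χ.lt_b_of_ball_subset hn
    (fun u hu v hv h => (hg u hu v hv h).trans_le hρ2) hρ hq
  set β : Fin (n + 1) → ℝ := fun j => χ.b q j - κ with hβ
  obtain ⟨η₀, hη₀, hlab⟩ := χ.exists_label_homotopy hqP (β := β)
    (fun j => by simp only [hβ]; linarith [hqκ j]) (fun j => by simp only [hβ]; linarith) hε
  set η := min (min η₀ ε) (min δ (ρ / 2)) with hη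
  have hηη₀ : η ≤ η₀ := (min_le_left _ _).trans (min_le_left _ _)
  have hηε : η ≤ ε := (min_le_left _ _).trans (min_le_right _ _)
  have hηδ : η ≤ δ := (min_le_right _ _).trans (min_le_left _ _)
  have hηρ : η ≤ ρ / 2 := (min_le_right _ _).trans (min_le_right _ _)
  refine ⟨η, by positivity, fun T hT z hz hbz => ?_⟩
  have hT₀ : χ.IsSubdiv η₀ T :=
    ⟨hT.1, fun L => ⟨fineChains_mono hηη₀ subset_rfl (hT.2 L).1, (hT.2 L).2⟩⟩
  obtain ⟨D, hD⟩ := hlab T hT₀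
  set z₁ : Chain M := z.filter fun s => (s : Set M) ⊆ χ.P with hz₁
  set z₂ : Chain M := z.filter fun s => ¬(s : Set M) ⊆ χ.P with hz₂
  have hzz : z = z₁ + z₂ := (Finsupp.filter_add_filter_not z _).symm
  have hz₁m : z₁ ∈ fineChains η χ.P (n + 1) := mem_supp fun s hs => by
    by_cases hsP : (s : Set M) ⊆ χ.P
    · rw [hz₁, Finsupp.filter_apply_pos (fun s : Finset M => (s : Set M) ⊆ χ.P) z hsP] at hs
      have := hz (Finsupp.mem_support_iff.2 hs)
      exact ⟨this.1, hsP, this.2.2⟩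
    · exact absurd (Finsupp.filter_apply_neg (fun s : Finset M => (s : Set M) ⊆ χ.P) z hsP) hs
  have hz₂P : ∀ s, z₂ s ≠ 0 → s ∈ fine η Set.univ (n + 1) ∧ ¬(s : Set M) ⊆ χ.P := fun s hs => by
    by_cases hsP : (s : Set M) ⊆ χ.P
    · exact absurd (Finsupp.filter_apply_neg (fun s : Finset M => ¬(s : Set M) ⊆ χ.P) z
        (not_not.2 hsP)) hs
    · rw [hz₂, Finsupp.filter_apply_pos (fun s : Finset M => ¬(s : Set M) ⊆ χ.P) z hsP] at hs
      exact ⟨hz (Finsupp.mem_support_iff.2 hs), hsP⟩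
  have hz₂m : z₂ ∈ fineChains η (ball q (ρ / 2))ᶜ (n + 1) := mem_supp fun s hs => by
    obtain ⟨hf, hsP⟩ := hz₂P s hs
    refine ⟨hf.1, fun a ha haq => hsP fun y hy => (hq ?_).1, hf.2.2⟩
    rw [mem_ball] at haq ⊢
    linarith [dist_triangle y a q, hf.2.2 y hy a ha]
  have hdeg : χ.deg q z₂ = 0 := by
    refine map_mem (φ := χ.deg q) (K := ⊥) (F := {s : Finset M | ¬(s : Set M) ⊆ χ.P})
      (fun s hs => ?_)
      (mem_supp fun s hs => (hz₂P s hs).2)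
    exact χ.deg_simplex_eq_zero fun h => hs h.1
  have hbz₁ : bd z₁ ∈ fineChains η (χ.P ∩ (ball q (ρ / 2))ᶜ) n := by
    refine inf_fine (bd_mem hz₁m) ?_
    have h1 : bd z₁ = bd z + bd z₂ := by
      rw [hzz, map_add, add_assoc, add_self, add_zero]
    rw [h1]
    exact add_mem (fineChains_mono le_rfl
      (Set.compl_subset_compl.2 (ball_subset_ball hρ2)) hbz) (bd_mem hz₂m)
  have hoff : ∀ s ∈ fine η (χ.P ∩ (ball q (ρ / 2))ᶜ) n,
      D (simplex s) ∈ fineChains ε (ball q (min δ (ρ / 2)))ᶜ (n + 1) := fun s hs => by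
    have hsP := hs.2.1.trans Set.inter_subset_left
    refine fineChains_mono le_rfl ?_
      (hD n (by omega) s ⟨hs.1, hsP, fun a ha b hb => (hs.2.2 a ha b hb).trans hηη₀⟩).1
    obtain ⟨a₀, ha₀⟩ : s.Nonempty := by rw [← Finset.card_pos, hs.1]; omega
    obtain ⟨j, hj⟩ := χ.exists_b_le hκ₀ hg hqP (hsP ha₀)
      (by simpa using (hs.2.1 ha₀).2)
    have hjs : ∀ a ∈ s, χ.b a j ≤ β j := fun a ha => by
      have h1 := abs_lt.1 (hb a (hsP ha) a₀ (hsP ha₀) ((hs.2.2 a ha a₀ ha₀).trans hηδ) j)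
      have h2 : κ₀ / (n + 1) = 2 * κ := by rw [hκ]; ring
      simp only [hβ]
      linarith [h1.2]
    rintro _ ⟨u, hu, rfl⟩ hmem
    have h1 := hu.2 j hjs
    have h2 := abs_lt.1 (hb (χ.g u) (χ.mapsTo_g u hu.1) q hqP
      ((mem_ball.1 hmem).le.trans (min_le_left _ _)) j)
    rw [χ.b_g u hu.1] at h2
    simp only [hβ] at h1
    linarith [h2.1]
  have hpush : push (χ.lab q) z₁ = χ.deg q z • simplex Finset.univ := by
    have hsub : fine η χ.P (n + 1) ⊆ {s | (s : Set M) ⊆ χ.P ∧ s.card = n + 1} :=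
      fun s hs => ⟨hs.2.1, hs.1⟩
    rw [hzz, map_add, hdeg, add_zero, χ.deg_eq_push q (Finsupp.supported_mono hsub hz₁m)]
    refine eq_smul_of_mem_supp_singleton (map_mem (fun s hs => ?_) hz₁m)
    rw [push_simplex]
    split_ifs with hc
    · exact simplex_mem (Finset.card_eq_iff_eq_univ _ |>.1 (by rw [hc, hs.1, Fintype.card_fin]))
    · exact zero_mem _
  have hDz : bd (D z₁) = z₁ + T (push (χ.lab q) z₁) + D (bd z₁) :=
    map_eq (φ := bd ∘ₗ D) (ψ := LinearMap.id + T ∘ₗ push (χ.lab q) + D ∘ₗ bd)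
      (fun s hs => (hD (n + 1) le_rfl s (fine_mono hηη₀ subset_rfl hs)).2) hz₁m
  refine ⟨D z₁, map_mem (fun s hs => fineChains_mono le_rfl (Set.subset_univ _)
    (hD (n + 1) le_rfl s (fine_mono hηη₀ subset_rfl hs)).1) hz₁m, ?_⟩
  have hfinal : z + χ.deg q z • T (simplex Finset.univ) + bd (D z₁) = z₂ + D (bd z₁) := by
    rw [hDz, hpush, map_smul]
    nth_rewrite 1 [hzz]
    set t := χ.deg q z • T (simplex Finset.univ)
    calc z₁ + z₂ + t + (z₁ + t + D (bd z₁)) = (z₁ + z₁) + (t + t) + (z₂ + D (bd z₁)) := by abel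
      _ = z₂ + D (bd z₁) := by rw [add_self, add_self, zero_add, zero_add]
  rw [hfinal]
  refine add_mem (fineChains_mono hηε
    (Set.compl_subset_compl.2 (ball_subset_ball (min_le_right _ _))) hz₂m) ?_
  exact map_mem hoff hbz₁

end LocalHomology

section FundamentalCycle

variable {n : ℕ} {M : Type*} [MetricSpace M] [DecidableEq M]

omit [DecidableEq M] in
lemma compl_ball_anti {q : M} {r r' : ℝ} (h : r' ≤ r) : (ball q r)ᶜ ⊆ (ball q r')ᶜ :=
  Set.compl_subset_compl.2 (ball_subset_ball h)

/-- The fundamental chains of two charts agree near a common interior point, up to a fine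
boundary. -/
theorem exists_subdiv_compare (𝒜 : Finset (SChart n M)) (hn : 1 ≤ n) {ρ : ℝ} (hρ : 0 < ρ) :
    ∃ ρ' > 0, ρ' ≤ ρ ∧ ∀ V : Finset M, ∀ ε > 0, ∃ η > 0, ∀ χ ∈ 𝒜, ∀ χ' ∈ 𝒜, ∀ q ∈ V,
      ball q ρ ⊆ χ.O → ball q ρ ⊆ χ'.O → ∀ T T', χ.IsSubdiv η T → χ'.IsSubdiv η T' →
      ∃ w ∈ fineChains ε Set.univ (n + 2),
        T' (simplex Finset.univ) + T (simplex Finset.univ) + bd w ∈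
          fineChains ε (ball q ρ')ᶜ (n + 1) := by
  obtain ⟨ρ₀, hρ₀, hloc⟩ := exists_common 𝒜
    (fun χ ρ' => ∀ q, ball q ρ ⊆ χ.O → ∀ ε > 0, ∃ η > 0, ∀ T, χ.IsSubdiv η T →
      ∀ z ∈ fineChains η Set.univ (n + 1), bd z ∈ fineChains η (ball q ρ)ᶜ n →
      ∃ w ∈ fineChains ε Set.univ (n + 2),
        z + χ.deg q z • T (simplex Finset.univ) + bd w ∈ fineChains ε (ball q ρ')ᶜ (n + 1))
    (fun χ r r' hr h q hq ε hε => by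
      obtain ⟨η, hη, h'⟩ := h q hq ε hε
      refine ⟨η, hη, fun T hT z hz hbz => ?_⟩
      obtain ⟨w, hw, hzw⟩ := h' T hT z hz hbz
      exact ⟨w, hw, fineChains_mono le_rfl (compl_ball_anti hr) hzw⟩)
    (fun χ _ => χ.local_homology hn hρ)
  refine ⟨min ρ₀ ρ, lt_min hρ₀ hρ, min_le_right _ _, fun V ε hε => ?_⟩
  obtain ⟨ε', hε', hA⟩ := exists_common (𝒜 ×ˢ V)
    (fun p ε => ball p.2 ρ ⊆ p.1.O → (∀ w ∈ fineChains ε Set.univ (n + 2), p.1.deg p.2 (bd w) = 0) ∧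
      ∀ y ∈ fineChains ε (ball p.2 ρ₀)ᶜ (n + 1), p.1.deg p.2 y = 0)
    (fun p r r' hr h hp => ⟨fun w hw => (h hp).1 w (fineChains_mono hr subset_rfl hw),
      fun w hw => (h hp).2 w (fineChains_mono hr subset_rfl hw)⟩)
    (fun p _ => by
      by_cases hp : ball p.2 ρ ⊆ p.1.O
      · obtain ⟨ε, hε, h⟩ := p.1.exists_deg_bd (hp (mem_ball_self hρ)) hρ₀
        exact ⟨ε, hε, fun _ => h⟩
      · exact ⟨1, one_pos, fun h => absurd h hp⟩)
  obtain ⟨η, hη, hB⟩ := exists_common (𝒜 ×ˢ V)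
    (fun p η => ball p.2 ρ ⊆ p.1.O → ∀ T, p.1.IsSubdiv η T →
      ∀ z ∈ fineChains η Set.univ (n + 1), bd z ∈ fineChains η (ball p.2 ρ)ᶜ n →
      ∃ w ∈ fineChains (min ε ε') Set.univ (n + 2),
        z + p.1.deg p.2 z • T (simplex Finset.univ) + bd w ∈
          fineChains (min ε ε') (ball p.2 ρ₀)ᶜ (n + 1))
    (fun p r r' hr h hp T hT z hz hbz => h hp T
      ⟨hT.1, fun L => ⟨fineChains_mono hr subset_rfl (hT.2 L).1, (hT.2 L).2⟩⟩ z
      (fineChains_mono hr subset_rfl hz) (fineChains_mono hr subset_rfl hbz))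
    (fun p hp => by
      by_cases hpO : ball p.2 ρ ⊆ p.1.O
      · obtain ⟨η, hη, h⟩ := hloc p.1 (Finset.mem_product.1 hp).1 p.2 hpO (min ε ε')
          (lt_min hε hε')
        exact ⟨η, hη, fun _ => h⟩
      · exact ⟨1, one_pos, fun h => absurd h hpO⟩)
  refine ⟨η, hη, fun χ hχ χ' hχ' q hq hqO hqO' T T' hT hT' => ?_⟩
  obtain ⟨w, hw, hoff⟩ := hB (χ, q) (Finset.mem_product.2 ⟨hχ, hq⟩) hqO T hT
    (T' (simplex Finset.univ)) (fineChains_mono le_rfl (Set.subset_univ _) hT'.top_mem)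
    (fineChains_mono le_rfl (Set.compl_subset_compl.2 hqO') hT'.bd_top_mem)
  obtain ⟨hA1, hA2⟩ := hA (χ', q) (Finset.mem_product.2 ⟨hχ', hq⟩) hqO'
  refine ⟨w, fineChains_mono (min_le_left _ _) subset_rfl hw,
    fineChains_mono (min_le_left ε ε') (compl_ball_anti (min_le_left _ _)) ?_⟩
  rcases (by decide : ∀ c : ZMod 2, c = 0 ∨ c = 1) (χ.deg q (T' (simplex Finset.univ))) with h | h
  · simp only [h, zero_smul, add_zero] at hoff
    have h1 := hA2 _ (fineChains_mono (min_le_right _ _) subset_rfl hoff)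
    simp only [map_add] at h1
    rw [hA1 w (fineChains_mono (min_le_right _ _) subset_rfl hw),
      hT'.deg_top (hqO' (mem_ball_self hρ)), add_zero] at h1
    exact absurd h1 one_ne_zero
  · simpa only [h, one_smul] using hoff

omit [DecidableEq M] in
theorem exists_atlas [CompactSpace M] (hM : IsTopManifold n M) (x : M) :
    ∃ (𝒜 : Finset (SChart n M)) (χ₀ : SChart n M) (ℓ : ℝ), 0 < ℓ ∧ χ₀ ∈ 𝒜 ∧ ball x ℓ ⊆ χ₀.O ∧
      ∀ y, ∃ χ ∈ 𝒜, ball y ℓ ⊆ χ.O := by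
  classical
  choose c hc using exists_schart hM
  obtain ⟨I, hI⟩ := isCompact_univ.elim_finite_subcover (fun p => (c p).O)
    (fun p => (c p).isOpen_interior) fun y _ => Set.mem_iUnion.2 ⟨y, hc y⟩
  obtain ⟨ℓ₁, hℓ₁, hleb⟩ := lebesgue_number_lemma_of_metric isCompact_univ
    (c := fun p : I => (c p).O) (fun p => (c p).isOpen_interior) (by
      intro y hy
      obtain ⟨p, hp, hy⟩ := Set.mem_iUnion₂.1 (hI hy)
      exact Set.mem_iUnion.2 ⟨⟨p, hp⟩, hy⟩)
  obtain ⟨ℓ₂, hℓ₂, hx⟩ := Metric.isOpen_iff.1 (c x).isOpen_interior x (hc x)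
  refine ⟨insert (c x) (I.image c), c x, min ℓ₁ ℓ₂, lt_min hℓ₁ hℓ₂, Finset.mem_insert_self _ _,
    (ball_subset_ball (min_le_right _ _)).trans hx, fun y => ?_⟩
  obtain ⟨p, hp⟩ := hleb y trivial
  exact ⟨c p, Finset.mem_insert_of_mem (Finset.mem_image_of_mem c p.2),
    (ball_subset_ball (min_le_left _ _)).trans hp⟩

end FundamentalCycle

section GlobalCycle

variable {n : ℕ} {M : Type*} [MetricSpace M] [DecidableEq M]

omit [DecidableEq M] in
lemma dist_image_le {f : M → M} {ε η : ℝ} (hf : ∀ y, dist (f y) y ≤ ε) (hη : η ≤ ε) {a b : M}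
    (h : dist a b ≤ η) : dist (f a) (f b) ≤ 3 * ε := by
  have h1 := dist_triangle4 (f a) a b (f b)
  have h2 := hf a
  have h3 := hf b
  rw [dist_comm] at h3
  linarith

lemma push_near_mem {f : M → M} {ε η : ℝ} (hf : ∀ y, dist (f y) y ≤ ε) (hη : η ≤ ε) {A B : Set M}
    (hAB : ∀ a ∈ A, f a ∈ B) {k : ℕ} {c : Chain M} (hc : c ∈ fineChains η A k) :
    push f c ∈ fineChains (3 * ε) B k :=
  push_mem hAB (fun _ _ _ _ h => dist_image_le hf hη h) hc

omit [DecidableEq M] in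
lemma notMem_ball_image {f : M → M} {ε : ℝ} (hf : ∀ y, dist (f y) y ≤ ε) {q : M} {r r' : ℝ}
    (hr : r + ε ≤ r') {a : M} (ha : a ∈ (ball q r')ᶜ) : f a ∈ (ball q r)ᶜ := by
  simp only [Set.mem_compl_iff, mem_ball, not_lt] at ha ⊢
  have h1 := dist_triangle a (f a) q
  have h2 := hf a
  rw [dist_comm] at h2
  linarith

omit [DecidableEq M] in
lemma apply_eq_zero_of_compl_ball {ε : ℝ} {q : M} {ρ : ℝ} {k : ℕ} {c : Chain M}
    (hc : c ∈ fineChains ε (ball q ρ)ᶜ k) {Δ : Finset M} {a : M} (ha : a ∈ Δ)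
    (haq : a ∈ ball q ρ) : c Δ = 0 :=
  apply_eq_zero hc fun h => h.2.1 ha haq

/-- A push-forward which lowers the dimension in a ball kills fine boundaries there. -/
lemma push_apply_eq_zero {f : M → M} {ε η R ρ : ℝ} (hf : ∀ y, dist (f y) y ≤ ε) (hη : η ≤ ε)
    {x q : M} (hdim : ∀ s : Finset M, (s : Set M) ⊆ ball x R →
      (∀ a ∈ s, ∀ b ∈ s, dist a b ≤ η) → (s.image f).card ≤ n + 1)
    (hR : 8 * ε ≤ R) (hρ : ε < ρ) {c w : Chain M} (hw : w ∈ fineChains η Set.univ (n + 2))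
    (hc : c + bd w ∈ fineChains η (ball q ρ)ᶜ (n + 1)) {Δ : Finset M} (hq : q ∈ Δ)
    (hqx : q ∈ ball x (3 * R / 4)) : push f c Δ = 0 := by
  have h1 := push_near_mem hf hη (B := (ball q (ρ - ε))ᶜ)
    (fun a ha => notMem_ball_image hf (by linarith) ha) hc
  have h2 : push f w ∈ fineChains (3 * ε) (ball x (3 * R / 4))ᶜ (n + 2) := by
    refine map_mem (fun s hs => ?_) hw
    by_cases hsR : (s : Set M) ⊆ ball x R
    · rw [push_simplex, if_neg]
      · exact zero_mem _
      · have := hdim s hsR hs.2.2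
        have := hs.1
        omega
    · obtain ⟨p, hp, hpR⟩ := Set.not_subset.1 hsR
      rw [← hs.1]
      refine push_simplex_mem (fun _ a ha => ?_)
        fun a ha b hb => dist_image_le hf hη (hs.2.2 a ha b hb)
      simp only [Set.mem_compl_iff, mem_ball, not_lt] at hpR ⊢
      have e1 := dist_triangle4 p a (f a) x
      have e2 := hs.2.2 p hp a ha
      have e3 := hf a
      rw [dist_comm] at e3
      linarith
  have h3 := apply_eq_zero_of_compl_ball h1 hq (mem_ball_self (by linarith))
  have h4 := apply_eq_zero_of_compl_ball (bd_mem h2) hq hqx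
  rwa [map_add, ← bd_push, Finsupp.add_apply, h4, add_zero] at h3

/-- A manifold carries, near a point where it is approximately at most `n`-dimensional, fine
`n`-chains of degree one whose boundary is far away. -/
theorem exists_local_cycle [CompactSpace M] (hM : IsTopManifold n M) (hn : 1 ≤ n) {x : M} {R : ℝ}
    (hR : 0 < R) (hdim : ∀ ε > 0, ∃ f : M → M, (Set.range f).Finite ∧ (∀ y, dist (f y) y ≤ ε) ∧
      ∃ η > 0, ∀ s : Finset M, (s : Set M) ⊆ ball x R →
        (∀ a ∈ s, ∀ b ∈ s, dist a b ≤ η) → (s.image f).card ≤ n + 1) :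
    ∃ χ : SChart n M, x ∈ χ.O ∧ ∀ ε > 0, ∃ z ∈ fineChains ε (ball x R) (n + 1),
      bd z ∈ fineChains ε (ball x (R / 2))ᶜ n ∧ χ.deg x z = 1 := by
  obtain ⟨𝒜, χ, ℓ, hℓ, hχ, hxO, hat⟩ := exists_atlas hM x
  choose c hc𝒜 hcO using hat
  have hxχ : x ∈ χ.O := hxO (mem_ball_self hℓ)
  obtain ⟨ρ, hρ, hρℓ, hcmp⟩ := exists_subdiv_compare 𝒜 hn (half_pos hℓ)
  have hr1 : 0 < min (R / 2) (ℓ / 2) := lt_min (half_pos hR) (half_pos hℓ)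
  obtain ⟨εx, hεx, hdeg1, hdeg2⟩ := χ.exists_deg_bd hxχ hr1
  refine ⟨χ, hxχ, fun ε₀ hε₀ => ?_⟩
  obtain ⟨ε, hε, hε0, hεεx, hερ, hεR, hεℓ⟩ : ∃ ε > 0, 3 * ε ≤ ε₀ ∧ 3 * ε ≤ εx ∧ ε < ρ ∧
      16 * ε ≤ R ∧ 6 * ε ≤ ℓ := by
    have hpos : 0 < min (min ε₀ εx) (min ρ (min R ℓ)) := by positivity
    refine ⟨min (min ε₀ εx) (min ρ (min R ℓ)) / 16, by positivity, ?_⟩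
    have a1 : min (min ε₀ εx) (min ρ (min R ℓ)) ≤ ε₀ := by simp
    have a2 : min (min ε₀ εx) (min ρ (min R ℓ)) ≤ εx := by simp
    have a3 : min (min ε₀ εx) (min ρ (min R ℓ)) ≤ ρ := by simp
    have a4 : min (min ε₀ εx) (min ρ (min R ℓ)) ≤ R := by simp
    have a5 : min (min ε₀ εx) (min ρ (min R ℓ)) ≤ ℓ := by simp
    refine ⟨?_, ?_, ?_, ?_, ?_⟩ <;> linarith
  obtain ⟨f, hfin, hf, ηf, hηf, hfdim⟩ := hdim ε hε
  obtain ⟨η₁, hη₁, hcmp⟩ := hcmp hfin.toFinset (min ηf ε) (lt_min hηf hε)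
  choose T hT using fun χ : SChart n M => χ.exists_isSubdiv (lt_min hη₁ hε)
  set G : SChart n M → Chain M := fun χ => push f (T χ (simplex Finset.univ)) with hG
  have hηε : min η₁ ε ≤ ε := min_le_right _ _
  have hGmem : ∀ χ, G χ ∈ fineChains (3 * ε) (Set.range f) (n + 1) := fun χ =>
    push_near_mem hf hηε (fun a _ => Set.mem_range_self a) (hT χ).top_mem
  have hcompat : ∀ χ ∈ 𝒜, ∀ χ' ∈ 𝒜, ∀ q ∈ Set.range f, ball q (ℓ / 2) ⊆ χ.O →
      ball q (ℓ / 2) ⊆ χ'.O → ∀ Δ : Finset M, q ∈ Δ → q ∈ ball x (3 * R / 4) →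
      G χ' Δ = G χ Δ := by
    intro χ hχ χ' hχ' q hq hqO hqO' Δ hqΔ hqx
    have hcv : ∀ χ : SChart n M, χ.IsSubdiv η₁ (T χ) := fun χ =>
      ⟨(hT χ).1, fun L => ⟨fineChains_mono (min_le_left _ _) subset_rfl ((hT χ).2 L).1,
        ((hT χ).2 L).2⟩⟩
    obtain ⟨w, hw, hoff⟩ := hcmp χ hχ χ' hχ' q (hfin.mem_toFinset.2 hq) hqO hqO' _ _ (hcv χ)
      (hcv χ')
    have := push_apply_eq_zero hf (min_le_right ηf ε) (fun s hs hd => hfdim s hs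
      fun a ha b hb => (hd a ha b hb).trans (min_le_left _ _)) (by linarith) hερ hw hoff hqΔ hqx
    rw [map_add, Finsupp.add_apply] at this
    exact CharTwo.add_eq_zero.1 this
  set Fam : Set (Finset M) := fine (3 * ε) (Set.range f ∩ ball x (3 * R / 4)) (n + 1) with hFam
  have hne : ∀ Δ ∈ Fam, Δ.Nonempty := fun Δ h => Finset.card_pos.1 (by rw [h.1]; omega)
  have : Nonempty M := ⟨x⟩
  choose! v hv using hne
  classical
  obtain ⟨z, hz⟩ : ∃ z : Chain M, ∀ Δ, z Δ = if Δ ∈ Fam then G (c (v Δ)) Δ else 0 := by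
    refine ⟨Finsupp.onFinset hfin.toFinset.powerset
      (fun Δ => if Δ ∈ Fam then G (c (v Δ)) Δ else 0) fun Δ h => ?_, fun Δ => rfl⟩
    have hΔ : Δ ∈ Fam := by
      by_contra h'
      exact h (if_neg h')
    exact Finset.mem_powerset.2 fun a ha => hfin.mem_toFinset.2 (hΔ.2.1 ha).1
  have hzFam : z ∈ fineChains (3 * ε) (Set.range f ∩ ball x (3 * R / 4)) (n + 1) := by
    refine mem_supp fun Δ h => ?_
    by_contra h'
    exact h (by rw [hz, if_neg h'])
  have hkey : ∀ χ ∈ 𝒜, ∀ q ∈ Set.range f, ball q (ℓ / 2) ⊆ χ.O → q ∈ ball x (R / 2) →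
      ∀ Δ, q ∈ Δ → (z + G χ) Δ = 0 := by
    intro χ hχ q hq hqO hqx Δ hqΔ
    rw [Finsupp.add_apply, hz]
    have hqx' : q ∈ ball x (3 * R / 4) := ball_subset_ball (by linarith) hqx
    split_ifs with hΔ
    · rw [hcompat χ hχ _ (hc𝒜 (v Δ)) q hq hqO _ Δ hqΔ hqx', CharTwo.add_self_eq_zero]
      refine (ball_subset_ball' ?_).trans (hcO (v Δ))
      have := hΔ.2.2 q hqΔ (v Δ) (hv Δ hΔ)
      linarith
    · rw [zero_add]
      by_contra hG0
      have hΔ' : Δ ∈ fine (3 * ε) (Set.range f) (n + 1) := by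
        by_contra h'
        exact hG0 (apply_eq_zero (hGmem χ) h')
      refine hΔ ⟨hΔ'.1, fun a ha => ⟨hΔ'.2.1 ha, ?_⟩, hΔ'.2.2⟩
      have h1 := dist_triangle a q x
      have h2 := hΔ'.2.2 a ha q hqΔ
      have h3 := mem_ball.1 hqx
      exact mem_ball.2 (by linarith)
  have hzG : ∀ χ, z + G χ ∈ fineChains (3 * ε) (Set.range f) (n + 1) := fun χ =>
    add_mem (fineChains_mono le_rfl Set.inter_subset_left hzFam) (hGmem χ)
  refine ⟨z, fineChains_mono hε0 (Set.inter_subset_right.trans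
    (ball_subset_ball (by linarith))) hzFam, fineChains_mono hε0 subset_rfl ?_, ?_⟩
  · have hbz : bd z ∈ fineChains (3 * ε) (Set.range f) n :=
      fineChains_mono le_rfl Set.inter_subset_left (bd_mem hzFam)
    refine mem_supp fun S hS => ?_
    have hSf : S ∈ fine (3 * ε) (Set.range f) n := by
      by_contra h'
      exact hS (apply_eq_zero hbz h')
    refine ⟨hSf.1, fun a ha hax => hS ?_, hSf.2.2⟩
    have hy : z + G (c a) ∈ fineChains (3 * ε) ({a}ᶜ) (n + 1) := by
      refine mem_supp fun Δ h => ?_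
      have hΔ : Δ ∈ fine (3 * ε) (Set.range f) (n + 1) := by
        by_contra h'
        exact h (apply_eq_zero (hzG _) h')
      refine ⟨hΔ.1, fun b hb hba => h ?_, hΔ.2.2⟩
      obtain rfl : b = a := hba
      exact hkey _ (hc𝒜 b) b (hSf.2.1 ha)
        ((ball_subset_ball (half_le_self hℓ.le)).trans (hcO b)) hax Δ hb
    have h1 : bd (z + G (c a)) S = 0 := apply_eq_zero (bd_mem hy) fun h => h.2.1 ha rfl
    have h2 : bd (G (c a)) S = 0 := by
      rw [hG, bd_push]
      refine apply_eq_zero_of_compl_ball (q := a) (ρ := ℓ - ε) (push_near_mem hf hηε (A := (c a).Oᶜ) (fun b hb =>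
        notMem_ball_image hf (r' := ℓ) (by linarith) fun h => hb (hcO a h)) (hT (c a)).bd_top_mem)
        ha (mem_ball_self (by linarith))
    rwa [map_add, Finsupp.add_apply, h2, add_zero] at h1
  · have hy : z + G χ ∈ fineChains (3 * ε) (ball x (min (R / 2) (ℓ / 2)))ᶜ (n + 1) := by
      refine mem_supp fun Δ h => ?_
      have hΔ : Δ ∈ fine (3 * ε) (Set.range f) (n + 1) := by
        by_contra h'
        exact h (apply_eq_zero (hzG _) h')
      refine ⟨hΔ.1, fun q hq hqx => h ?_, hΔ.2.2⟩
      have hqx1 : dist q x < ℓ / 2 := lt_of_lt_of_le hqx (min_le_right _ _)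
      exact hkey χ hχ q (hΔ.2.1 hq) ((ball_subset_ball' (by linarith)).trans hxO)
        (ball_subset_ball (min_le_left _ _) hqx) Δ hq
    have h1 := hdeg2 _ (fineChains_mono hεεx subset_rfl hy)
    obtain ⟨D, hDbd, hD⟩ := exists_fine_prism (id : M → M) f
    have hDd : ∀ A : Set M, ∀ a ∈ A, ∀ b ∈ A, dist a b ≤ min η₁ ε → dist (id a) (id b) ≤ 3 * ε ∧
        dist (id a) (f b) ≤ 3 * ε ∧ dist (f a) (f b) ≤ 3 * ε := by
      intro A a _ b _ hab
      have h2 := dist_triangle a b (f b)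
      have h3 := hf b
      rw [dist_comm] at h3
      refine ⟨by simp only [id]; linarith, by simp only [id]; linarith, dist_image_le hf hηε hab⟩
    have h2 := hdeg1 _ (fineChains_mono hεεx subset_rfl (hD _ _ Set.univ Set.univ _
      (fun _ _ => trivial) (fun _ _ => trivial) (hDd _) _
      (fineChains_mono le_rfl (Set.subset_univ _) (hT χ).top_mem)))
    have h3 := hdeg2 _ (fineChains_mono hεεx subset_rfl (hD _ _ χ.Oᶜ
      (ball x (min (R / 2) (ℓ / 2)))ᶜ _
      (fun a ha h => ha (hxO (ball_subset_ball ((min_le_right _ _).trans (by linarith)) h)))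
      (fun a ha => notMem_ball_image hf (r' := ℓ)
        (by have := min_le_right (R / 2) (ℓ / 2); linarith) fun h => ha (hxO h)) (hDd _) _
      (hT χ).bd_top_mem))
    rw [hDbd, push_eq_self (f := id) (fun _ _ _ _ => rfl) (hT χ).top_mem, map_add, map_add, h3, add_zero,
      (hT χ).deg_top hxχ] at h2
    rw [map_add, ← CharTwo.add_eq_zero.1 h2] at h1
    exact CharTwo.add_eq_zero.1 h1

end GlobalCycle

section Refinement

/-- The scale, relative to the initial one, at which a `k`-vertex simplex can be refined in a
space in which balls can be filled in balls `C` times larger. -/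
noncomputable def fillRadius (C : ℝ) : ℕ → ℝ
  | 0 => 0
  | k + 1 => C * (fillRadius C k + 1) + 1

lemma fillRadius_nonneg {C : ℝ} (hC : 1 ≤ C) (k : ℕ) : 0 ≤ fillRadius C k := by
  induction k with
  | zero => exact le_rfl
  | succ k ih => simp only [fillRadius]; positivity

lemma fillRadius_mono {C : ℝ} (hC : 1 ≤ C) : Monotone (fillRadius C) := by
  refine monotone_nat_of_le_succ fun k => ?_
  have := fillRadius_nonneg hC k
  simp only [fillRadius]
  nlinarith

lemma one_le_fillRadius {C : ℝ} (hC : 1 ≤ C) {k : ℕ} (hk : k ≠ 0) : 1 ≤ fillRadius C k := by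
  obtain ⟨k, rfl⟩ := Nat.exists_eq_succ_of_ne_zero hk
  have := fillRadius_nonneg hC k
  simp only [fillRadius]
  nlinarith

variable {M : Type*} [MetricSpace M] [DecidableEq M] [CompactSpace M]

theorem exists_fillsAt {L : ℝ} (hM : IsLLC L M) {σ : ℝ} (hσ : 0 < σ)
    (hdiam : 4 * σ ≤ diam (Set.univ : Set M) / L) {ε : ℝ} (hε : 0 < ε) :
    ∃ η > 0, ∀ p : M, FillsAt (closedBall p σ) (closedBall p ((4 * L + 1) * σ)) η ε := by
  obtain ⟨I, hI⟩ := isCompact_univ.elim_finite_subcover (fun p : M => ball p σ)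
    (fun p => isOpen_ball) fun y _ => Set.mem_iUnion.2 ⟨y, mem_ball_self hσ⟩
  obtain ⟨η, hη, h⟩ := exists_common I
    (fun q η => FillsAt (closedBall q (2 * σ)) (ball q (L * (4 * σ))) η ε)
    (fun q η η' h hf => hf.anti h) fun q _ => by
      obtain ⟨h, hc, h0, ⟨c, h1⟩, hB⟩ := hM q (4 * σ) (by positivity) hdiam
      have hsub : closedBall q (2 * σ) ⊆ ball q (4 * σ) := closedBall_subset_ball (by linarith)
      refine fillsAt_of_contraction (isCompact_closedBall q _) h
        (hc.mono (Set.prod_mono subset_rfl hsub)) (fun a ha => h0 a (hsub ha)) (c := c) ?_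
        (fun a ha => h1 a (hsub ha)) (fun t ht a ha => hB t ht a (hsub ha)) hε
      have hq : q ∈ ball q (4 * σ) := mem_ball_self (by positivity)
      rw [← h1 q hq]
      exact hB 1 ⟨zero_le_one, le_rfl⟩ q hq
  refine ⟨η, hη, fun p k z hz hbz => ?_⟩
  obtain ⟨q, hq, hpq⟩ := Set.mem_iUnion₂.1 (hI (Set.mem_univ p))
  rw [mem_ball] at hpq
  obtain ⟨w, hw, hwz⟩ := h q hq k z
    (fineChains_mono le_rfl (closedBall_subset_closedBall' (by linarith)) hz) hbz
  refine ⟨w, fineChains_mono le_rfl (ball_subset_closedBall.trans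
    (closedBall_subset_closedBall' ?_)) hw, hwz⟩
  rw [dist_comm]
  linarith

/-- In a linearly locally contractible space, coarse simplices can be refined to fine chains. -/
theorem exists_refinement {L : ℝ} (hL : 1 ≤ L) (hM : IsLLC L M) (N : ℕ) {δ : ℝ} (hδ : 0 < δ)
    (hdiam : 4 * ((fillRadius (4 * L + 1) N + 1) * δ) ≤ diam (Set.univ : Set M) / L)
    {ε : ℝ} (hε : 0 < ε) :
    ∃ ε₀ > 0, ∃ T : Chain M →ₗ[ZMod 2] Chain M,
      (∀ k, ∀ c ∈ fineChains ε₀ Set.univ k, T c = c) ∧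
      (∀ k ≤ N, ∀ c ∈ fineChains δ Set.univ k, bd (T c) = T (bd c)) ∧
      ∀ k ≤ N, ∀ A B : Set M,
        (∀ y, ∀ a ∈ A, dist y a ≤ fillRadius (4 * L + 1) N * δ → y ∈ B) →
        ∀ c ∈ fineChains δ A (k + 1), k + 1 ≤ N → T c ∈ fineChains ε B (k + 1) := by
  set C := 4 * L + 1
  have hC : 1 ≤ C := by simp only [C]; linarith
  have hpos := fillRadius_nonneg hC
  obtain ⟨e, he, hmono, hle, hstep⟩ := exists_ladder
    (fun k η ε => k < N → ∀ p : M, FillsAt (closedBall p ((fillRadius C k + 1) * δ))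
      (closedBall p (C * ((fillRadius C k + 1) * δ))) η ε)
    (fun k ε hε => by
      by_cases hk : k < N
      · have h1 := hpos k
        have h2 := fillRadius_mono hC hk.le
        obtain ⟨η, hη, h⟩ := exists_fillsAt hM (σ := (fillRadius C k + 1) * δ) (by positivity)
          (le_trans (by gcongr) hdiam) hε
        exact ⟨η, hη, fun _ => h⟩
      · exact ⟨1, one_pos, fun h => absurd h hk⟩)
    (fun k η η' ε h hf hk p => (hf hk p).anti h) N hε
  set ε₀ := min (e 0) δ
  have hlift := exists_lift
    (S := {s : Finset M | s.card ≤ N ∧ ∀ a ∈ s, ∀ b ∈ s, dist a b ≤ δ})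
    (S₀ := {s : Finset M | ∀ a ∈ s, ∀ b ∈ s, dist a b ≤ ε₀})
    (fun s hs v _ => ⟨(Finset.card_le_card (Finset.erase_subset _ _)).trans hs.1, fun a ha b hb =>
      hs.2 a (Finset.mem_of_mem_erase ha) b (Finset.mem_of_mem_erase hb)⟩)
    (fun s hs v _ a ha b hb => hs a (Finset.mem_of_mem_erase ha) b (Finset.mem_of_mem_erase hb))
    0 LinearMap.id (by simp)
    (fun s => fineChains (e s.card) {y | ∀ a ∈ s, dist y a ≤ fillRadius C s.card * δ} s.card)
    (fun s hs => ⟨simplex_mem ⟨rfl, fun y hy a ha => by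
      have h1 := one_le_fillRadius hC (Finset.card_ne_zero_of_mem ha)
      have h2 := (hs y hy a ha).trans (min_le_right _ _)
      nlinarith, fun a ha b hb =>
      ((hs a ha b hb).trans (min_le_left _ _)).trans (hmono (Nat.zero_le _))⟩, by simp⟩)
    fun s hs hs₀ c hc hbd => by
    simp only [LinearMap.zero_apply, zero_add] at hbd ⊢
    have hk2 : 2 ≤ s.card := by
      by_contra h
      refine hs₀ fun a ha b hb => ?_
      rw [Finset.card_le_one.1 (by omega) a ha b hb, dist_self]
      exact (lt_min (he 0) hδ).le
    obtain ⟨k, hk⟩ : ∃ k, s.card = k + 1 := ⟨s.card - 1, by omega⟩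
    obtain ⟨p, hp⟩ : s.Nonempty := Finset.card_pos.1 (by omega)
    have hkN : k < N := by have := hs.1; omega
    have hsum : ∑ v ∈ s, c v ∈ fineChains (e k) (closedBall p ((fillRadius C k + 1) * δ)) k := by
      refine sum_mem fun v hv => ?_
      have h1 := hc v hv
      have h2 : (s.erase v).card = k := by rw [Finset.card_erase_of_mem hv, hk]; rfl
      rw [h2] at h1
      refine fineChains_mono le_rfl (fun y hy => ?_) h1
      obtain ⟨a, ha⟩ : (s.erase v).Nonempty := Finset.card_pos.1 (by omega)
      have h3 := hy a ha
      have h4 := hs.2 a (Finset.mem_of_mem_erase ha) p hp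
      have h5 := dist_triangle y a p
      rw [mem_closedBall]
      linarith
    obtain ⟨w, hw, hwb⟩ := hstep k hkN hkN p k _ hsum hbd
    refine ⟨w, ?_, hwb⟩
    rw [hk]
    refine fineChains_mono le_rfl (fun y hy a ha => ?_) hw
    have h1 := hs.2 p hp a ha
    have h2 := dist_triangle y p a
    rw [mem_closedBall] at hy
    simp only [fillRadius]
    linarith
  obtain ⟨D, hD₀, hD⟩ := hlift
  refine ⟨ε₀, lt_min (he 0) hδ, D, fun k c hc => ?_, fun k hk c hc => ?_,
    fun k _ A B hAB c hc hk => ?_⟩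
  · exact map_eq (ψ := LinearMap.id) (fun s hs => hD₀ s hs.2.2) hc
  · refine map_eq (φ := bd ∘ₗ D) (ψ := D ∘ₗ bd) (fun s hs => ?_) hc
    simpa using (hD s ⟨hs.1.trans_le hk, hs.2.2⟩).2
  · refine map_mem (fun s hs => ?_) hc
    have h1 := (hD s ⟨hs.1.trans_le hk, hs.2.2⟩).1
    rw [hs.1] at h1
    refine fineChains_mono (hle _) (fun y hy => ?_) h1
    obtain ⟨a, ha⟩ : s.Nonempty := Finset.card_pos.1 (by rw [hs.1]; omega)
    exact hAB y a (hs.2.1 ha) ((hy a ha).trans (by gcongr; exact fillRadius_mono hC hk))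

end Refinement

section ReducingMap

variable {M : Type*} [MetricSpace M]

/-- The set of radii for which some point of `B` lies on prescribed spheres is small. -/
lemma volume_bad_radii_le [MeasurableSpace M] [BorelSpace M] {N : ℕ} (p : Fin N → M) (B : Set M)
    (δ : ℝ) {m : ℕ} {I : Finset (Fin N)} (hI : I.card = m) :
    volume {ρ : Fin N → ℝ | (∀ i, ρ i ∈ Set.Icc δ (2 * δ)) ∧ ∃ y ∈ B, ∀ i ∈ I, dist y (p i) = ρ i}
      ≤ μH[(m : ℝ)] B * ENNReal.ofReal δ ^ (N - m) := by
  classical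
  set φ : M → ({i // i ∈ I} → ℝ) := fun y i => dist y (p i) with hφ
  have hLip : LipschitzWith 1 φ := by
    refine LipschitzWith.of_dist_le_mul fun y y' => ?_
    rw [NNReal.coe_one, one_mul, dist_pi_le_iff dist_nonneg]
    exact fun i => abs_dist_sub_le _ _ _
  have hvol : volume (φ '' B) ≤ μH[(m : ℝ)] B := by
    have h1 := hLip.hausdorffMeasure_image_le (Nat.cast_nonneg m) B
    rw [ENNReal.coe_one, ENNReal.one_rpow, one_mul] at h1
    have h2 := hausdorffMeasure_pi_real (ι := {i // i ∈ I})
    rw [Fintype.card_coe, hI] at h2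
    rwa [h2] at h1
  set S : Set ({i // ¬ i ∈ I} → ℝ) := Set.univ.pi fun _ => Set.Icc δ (2 * δ)
  have hS : volume S = ENNReal.ofReal δ ^ (N - m) := by
    have hc : Fintype.card {i // ¬ i ∈ I} = N - m := by
      rw [Fintype.card_subtype_compl, Fintype.card_fin, Fintype.card_coe, hI]
    simp only [S, volume_pi_pi, Real.volume_Icc, Finset.prod_const, Finset.card_univ, hc]
    congr 2
    ring
  have hpres := volume_preserving_piEquivPiSubtypeProd (fun _ : Fin N => ℝ) (fun i => i ∈ I)
  calc _ ≤ volume (MeasurableEquiv.piEquivPiSubtypeProd (fun _ : Fin N => ℝ) (fun i => i ∈ I) ⁻¹'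
        ((φ '' B) ×ˢ S)) := by
        refine measure_mono ?_
        rintro ρ ⟨hρ, y, hy, hyρ⟩
        exact ⟨⟨y, hy, funext fun i => hyρ i i.2⟩, fun i _ => hρ i⟩
    _ = volume (φ '' B) * volume S := by
        rw [hpres.measure_preimage_equiv, Measure.volume_eq_prod, Measure.prod_prod]
        congr!
    _ ≤ _ := by
        rw [hS]
        gcongr

lemma exists_avoiding_radii [MeasurableSpace M] [BorelSpace M] {N : ℕ} (p : Fin N → M) (B : Set M)
    {δ : ℝ} (hδ : 0 < δ) {m : ℕ} (h : 2 ^ N * μH[(m : ℝ)] B < ENNReal.ofReal (δ ^ m)) :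
    ∃ ρ : Fin N → ℝ, (∀ i, ρ i ∈ Set.Icc δ (2 * δ)) ∧
      ∀ I : Finset (Fin N), I.card = m → ∀ y ∈ B, ∃ i ∈ I, dist y (p i) ≠ ρ i := by
  by_cases hmN : N < m
  · refine ⟨fun _ => δ, fun _ => ⟨le_rfl, by linarith⟩, fun I hI => ?_⟩
    have := I.card_le_univ
    rw [Fintype.card_fin] at this
    omega
  by_contra! hcon
  have hsub : (Set.univ.pi fun _ : Fin N => Set.Icc δ (2 * δ)) ⊆
      ⋃ I ∈ (Finset.powersetCard m (Finset.univ : Finset (Fin N))),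
        {ρ : Fin N → ℝ | (∀ i, ρ i ∈ Set.Icc δ (2 * δ)) ∧
          ∃ y ∈ B, ∀ i ∈ I, dist y (p i) = ρ i} := by
    intro ρ hρ
    obtain ⟨I, hI, y, hy, hyI⟩ := hcon ρ fun i => hρ i trivial
    exact Set.mem_iUnion₂.2 ⟨I, Finset.mem_powersetCard.2 ⟨Finset.subset_univ _, hI⟩,
      fun i => hρ i trivial, y, hy, hyI⟩
  have h1 := (measure_mono (μ := volume) hsub).trans (measure_biUnion_finset_le _ _)
  have h2 := h1.trans (Finset.sum_le_sum fun I hI =>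
    volume_bad_radii_le p B δ (Finset.mem_powersetCard.1 hI).2)
  rw [Finset.sum_const, nsmul_eq_mul, Finset.card_powersetCard, Finset.card_univ,
    Fintype.card_fin, volume_pi_pi] at h2
  simp only [Real.volume_Icc, Finset.prod_const, Finset.card_univ, Fintype.card_fin] at h2
  have hδ' : 2 * δ - δ = δ := by ring
  rw [hδ'] at h2
  have hpow : ENNReal.ofReal δ ^ N = ENNReal.ofReal (δ ^ m) * ENNReal.ofReal δ ^ (N - m) := by
    rw [ENNReal.ofReal_pow hδ.le, ← pow_add]
    congr 1
    omega
  have hch : (N.choose m : ENNReal) ≤ 2 ^ N := by exact_mod_cast Nat.choose_le_two_pow N m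
  have hpos : ENNReal.ofReal δ ^ (N - m) ≠ 0 := pow_ne_zero _ (by simpa using hδ)
  have htop : ENNReal.ofReal δ ^ (N - m) ≠ ⊤ := ENNReal.pow_ne_top ENNReal.ofReal_ne_top
  rw [hpow] at h2
  refine absurd h2 (not_le.2 ?_)
  rw [← mul_assoc]
  exact ENNReal.mul_lt_mul_left hpos htop (lt_of_le_of_lt (by gcongr) h)

/-- A map which collapses small balls to their centres, lowering the dimension on the set `K`. -/
theorem exists_reducing_map [DecidableEq M] [MeasurableSpace M] [BorelSpace M] {N : ℕ}
    (p : Fin N → M) {B K : Set M} (hK : IsCompact K) (hKB : K ⊆ B) {δ : ℝ} (hδ : 0 < δ) {m : ℕ}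
    (h : 2 ^ N * μH[(m : ℝ)] B < ENNReal.ofReal (δ ^ m))
    (hcov : ∀ y ∈ K, ∃ i, dist y (p i) < δ) :
    ∃ f : M → M, (∀ y, dist (f y) y ≤ 2 * δ) ∧
      (∀ y, (∃ i, dist y (p i) < δ) → f y ∈ Set.range p) ∧
      ∃ η > 0, ∀ s : Finset M, (s : Set M) ⊆ K → (∀ a ∈ s, ∀ b ∈ s, dist a b ≤ η) →
        (s.image f).card ≤ m := by
  obtain ⟨ρ, hρ, hav⟩ := exists_avoiding_radii p B hδ h
  have hleast : ∀ y, (∃ i, dist y (p i) < ρ i) →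
      ∃ i, dist y (p i) < ρ i ∧ ∀ j < i, ρ j ≤ dist y (p j) := by
    rintro y ⟨i, hi⟩
    have := (Finset.univ.filter fun i => dist y (p i) < ρ i).exists_minimal ⟨i, by simpa using hi⟩
    obtain ⟨i, hi, hmin⟩ := this
    refine ⟨i, by simpa using hi, fun j hj => ?_⟩
    by_contra hj'
    exact absurd (hmin (y := j) (by simpa using hj') hj.le) (not_le.2 hj)
  have hf : ∀ y, ∃ z, (∀ i, dist y (p i) < ρ i → (∀ j < i, ρ j ≤ dist y (p j)) → z = p i) ∧
      ((∀ i, ρ i ≤ dist y (p i)) → z = y) := by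
    intro y
    by_cases hy : ∃ i, dist y (p i) < ρ i
    · obtain ⟨i, hi, hmin⟩ := hleast y hy
      refine ⟨p i, fun j hj hjmin => ?_, fun h => absurd (h i) (not_le.2 hi)⟩
      rcases lt_trichotomy i j with hij | rfl | hij
      · exact absurd (hjmin i hij) (not_le.2 hi)
      · rfl
      · exact absurd (hmin j hij) (not_le.2 hj)
    · exact ⟨y, fun i hi => absurd ⟨i, hi⟩ hy, fun _ => rfl⟩
  choose f hf hf' using hf
  refine ⟨f, fun y => ?_, fun y hy => ?_, ?_⟩
  · by_cases hy : ∃ i, dist y (p i) < ρ i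
    · obtain ⟨i, hi, hmin⟩ := hleast y hy
      rw [hf y i hi hmin, dist_comm]
      exact hi.le.trans (hρ i).2
    · push Not at hy
      rw [hf' y hy, dist_self]
      positivity
  · obtain ⟨i, hi⟩ := hy
    obtain ⟨i, hi, hmin⟩ := hleast y ⟨i, hi.trans_le (hρ i).1⟩
    exact ⟨i, (hf y i hi hmin).symm⟩
  · have hloc : ∀ y : K, ∃ U : Set M, IsOpen U ∧ (y : M) ∈ U ∧
        ∃ J : Finset (Fin N), J.card ≤ m ∧ ∀ u ∈ U, f u ∈ J.image p := by
      rintro ⟨y, hy⟩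
      obtain ⟨i, hi⟩ := hcov y hy
      obtain ⟨i, hi, hmin⟩ := hleast y ⟨i, hi.trans_le (hρ i).1⟩
      have hm : m ≠ 0 := by
        rintro rfl
        obtain ⟨j, hj, -⟩ := hav ∅ rfl y (hKB hy)
        exact absurd hj (Finset.notMem_empty j)
      refine ⟨{u | dist u (p i) < ρ i ∧ ∀ j, ρ j < dist y (p j) → ρ j < dist u (p j)}, ?_,
        ⟨hi, fun _ h => h⟩, insert i (Finset.univ.filter fun j => dist y (p j) = ρ j), ?_, ?_⟩
      · refine IsOpen.inter (isOpen_lt (by fun_prop) continuous_const : IsOpen {u | dist u (p i) < ρ i})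
          (?_ : IsOpen {u | ∀ j, ρ j < dist y (p j) → ρ j < dist u (p j)})
        simp only [Set.ofPred_forall]
        exact isOpen_iInter_of_finite fun j => isOpen_iInter_of_finite fun _ =>
          isOpen_lt (by fun_prop) (by fun_prop)
      · refine (Finset.card_insert_le _ _).trans ?_
        by_contra hcard
        obtain ⟨I, hI, hIm⟩ := Finset.exists_subset_card_eq (n := m)
          (s := Finset.univ.filter fun j => dist y (p j) = ρ j) (by omega)
        obtain ⟨j, hj, hne⟩ := hav I hIm y (hKB hy)
        exact hne (by simpa using hI hj)
      · rintro u ⟨hu, hu'⟩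
        obtain ⟨j, hj, hjmin⟩ := hleast u ⟨i, hu⟩
        rw [hf u j hj hjmin]
        refine Finset.mem_image_of_mem p ?_
        have hji : j ≤ i := not_lt.1 fun hij => absurd (hjmin i hij) (not_le.2 hu)
        rcases hji.eq_or_lt with rfl | hji
        · exact Finset.mem_insert_self _ _
        · refine Finset.mem_insert_of_mem ?_
          rw [Finset.mem_filter_univ]
          refine le_antisymm ?_ (hmin j hji)
          by_contra hlt
          exact absurd (hu' j (not_le.1 hlt)) (not_lt.2 hj.le)
    choose U hUo hyU J hJ hUJ using hloc
    obtain ⟨η, hη, hleb⟩ := lebesgue_number_lemma_of_metric hK hUo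
      fun y hy => Set.mem_iUnion.2 ⟨⟨y, hy⟩, hyU ⟨y, hy⟩⟩
    refine ⟨η / 2, half_pos hη, fun s hs hd => ?_⟩
    rcases s.eq_empty_or_nonempty with rfl | ⟨u, hu⟩
    · simp
    obtain ⟨y, hy⟩ := hleb u (hs hu)
    refine (Finset.card_le_card (t := (J y).image p) ?_).trans (Finset.card_image_le.trans (hJ y))
    intro q hq
    obtain ⟨b, hb, rfl⟩ := Finset.mem_image.1 hq
    exact hUJ y b (hy (mem_ball.2 ((hd b hb u hu).trans_lt (half_lt_self hη))))

end ReducingMap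

section Volume

variable {M : Type*} [MetricSpace M]

lemma exists_cover_of_isDoubling {D : ℕ} (hM : IsDoubling D M) (z : M) (r : ℝ) :
    ∃ s : Finset M, s.card ≤ D ∧ ∀ y ∈ ball z r, ∃ a ∈ s, dist y a < r / 2 := by
  classical
  let P : ℕ → Prop := fun k => ∃ s : Finset M, (s : Set M) ⊆ ball z r ∧
    (∀ a ∈ s, ∀ b ∈ s, a ≠ b → r / 2 ≤ dist a b) ∧ s.card = k
  have h0 : P 0 := ⟨∅, by simp, by simp, rfl⟩
  obtain ⟨s, hs, hsep, hcard⟩ := Nat.findGreatest_spec (P := P) (Nat.zero_le D) h0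
  refine ⟨s, hM z r s hs hsep, fun y hy => ?_⟩
  by_contra! hcon
  have hys : y ∉ s := by
    intro hys
    have h1 := hcon y hys
    have h2 := mem_ball.1 hy
    have h3 := dist_nonneg (x := y) (y := z)
    rw [dist_self] at h1
    linarith
  have hs' : ((insert y s : Finset M) : Set M) ⊆ ball z r := by
    rw [Finset.coe_insert]
    exact Set.insert_subset hy hs
  have hsep' : ∀ a ∈ insert y s, ∀ b ∈ insert y s, a ≠ b → r / 2 ≤ dist a b := by
    intro a ha b hb hab
    rcases Finset.mem_insert.1 ha with rfl | ha' <;> rcases Finset.mem_insert.1 hb with rfl | hb'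
    · exact absurd rfl hab
    · exact hcon b hb'
    · rw [dist_comm]
      exact hcon a ha'
    · exact hsep a ha' b hb' hab
  have h1 := Nat.le_findGreatest (P := P) (hM z r _ hs' hsep') ⟨_, hs', hsep', rfl⟩
  rw [Finset.card_insert_of_notMem hys] at h1
  omega

lemma exists_iterated_cover_of_isDoubling {D : ℕ} (hM : IsDoubling D M) (z : M) (r : ℝ) (k : ℕ) :
    ∃ s : Finset M, s.card ≤ D ^ k ∧ ∀ y ∈ ball z r, ∃ a ∈ s, dist y a < r / 2 ^ k := by
  classical
  induction k with
  | zero => exact ⟨{z}, by simp, fun y hy => ⟨z, by simp, by simpa using hy⟩⟩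
  | succ k ih =>
    obtain ⟨s, hs, hcov⟩ := ih
    choose t ht htcov using fun a : M => exists_cover_of_isDoubling hM a (r / 2 ^ k)
    refine ⟨s.biUnion t, ?_, fun y hy => ?_⟩
    · rw [pow_succ]
      exact (Finset.card_biUnion_le_card_mul s t D fun a _ => ht a).trans
        (Nat.mul_le_mul_right D hs)
    · obtain ⟨a, ha, hya⟩ := hcov y hy
      obtain ⟨b, hb, hyb⟩ := htcov a y hya
      refine ⟨b, Finset.mem_biUnion.2 ⟨a, ha, hb⟩, ?_⟩
      rwa [pow_succ, ← div_div]

lemma exists_fin_centers {s : Finset M} {A : Set M} {δ : ℝ}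
    (h : ∀ y ∈ A, ∃ a ∈ s, dist y a < δ) :
    ∃ p : Fin s.card → M, ∀ y ∈ A, ∃ i, dist y (p i) < δ := by
  refine ⟨fun i => s.equivFin.symm i, fun y hy => ?_⟩
  obtain ⟨a, ha, hya⟩ := h y hy
  exact ⟨s.equivFin ⟨a, ha⟩, by simpa using hya⟩

variable [CompactSpace M] [MeasurableSpace M] [BorelSpace M] [DecidableEq M]

/-- A ball of finite `n`-dimensional Hausdorff measure is approximately at most
`n`-dimensional. -/
theorem exists_fine_reducing_map {n : ℕ} {x : M} {r : ℝ} (hr : 0 < r)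
    (hfin : μH[(n : ℝ)] (ball x r) ≠ ⊤) {ε : ℝ} (hε : 0 < ε) :
    ∃ f : M → M, (Set.range f).Finite ∧ (∀ y, dist (f y) y ≤ ε) ∧
      ∃ η > 0, ∀ s : Finset M, (s : Set M) ⊆ ball x (r / 2) →
        (∀ a ∈ s, ∀ b ∈ s, dist a b ≤ η) → (s.image f).card ≤ n + 1 := by
  obtain ⟨I, hI⟩ := isCompact_univ.elim_finite_subcover (fun p : M => ball p (ε / 2))
    (fun p => isOpen_ball) fun y _ => Set.mem_iUnion.2 ⟨y, mem_ball_self (half_pos hε)⟩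
  obtain ⟨p, hp⟩ := exists_fin_centers (s := I) (A := Set.univ) (δ := ε / 2) fun y hy => by
    obtain ⟨a, ha, hya⟩ := Set.mem_iUnion₂.1 (hI hy)
    exact ⟨a, ha, hya⟩
  have hzero : μH[((n + 1 : ℕ) : ℝ)] (ball x r) = 0 :=
    (Measure.hausdorffMeasure_zero_or_top (by push_cast; linarith) _).resolve_right hfin
  obtain ⟨f, hf, hrange, η, hη, hdim⟩ := exists_reducing_map p (isCompact_closedBall x (r / 2))
    (closedBall_subset_ball (half_lt_self hr)) (half_pos hε) (m := n + 1)
    (by rw [hzero, mul_zero]; exact ENNReal.ofReal_pos.2 (by positivity))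
    fun y _ => hp y trivial
  refine ⟨f, (Set.finite_range p).subset ?_, fun y => (hf y).trans (by linarith), η, hη,
    fun s hs => hdim s (hs.trans ball_subset_closedBall)⟩
  rintro _ ⟨y, rfl⟩
  exact hrange y (hp y trivial)

/-- In a linearly locally contractible manifold, a ball cannot be collapsed onto an
`(n - 1)`-dimensional complex by a small displacement. -/
theorem not_exists_coarse_reducing_map {n : ℕ} {L : ℝ} (hn : 1 ≤ n) (hL : 1 ≤ L)
    (hM : IsTopManifold n M) (hLLC : IsLLC L M) {x : M} {r : ℝ} (hr : 0 < r)
    (hrd : r ≤ diam (Set.univ : Set M)) (hfin : μH[(n : ℝ)] (ball x r) ≠ ⊤) {δ : ℝ} (hδ : 0 < δ)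
    (hδr : 40 * (fillRadius (4 * L + 1) (n + 2) + 1) * L * δ ≤ r) {f : M → M}
    (hf : ∀ y, dist (f y) y ≤ 2 * δ) {η : ℝ} (hη : 0 < η)
    (hdim : ∀ s : Finset M, (s : Set M) ⊆ closedBall x (r / 2) →
      (∀ a ∈ s, ∀ b ∈ s, dist a b ≤ η) → (s.image f).card ≤ n) : False := by
  have hF := fillRadius_nonneg (C := 4 * L + 1) (by linarith) (n + 2)
  set F := fillRadius (4 * L + 1) (n + 2)
  have hFδ : 40 * ((F + 1) * δ) ≤ r := by
    refine le_trans ?_ hδr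
    have : (F + 1) * δ ≤ (F + 1) * δ * L := le_mul_of_one_le_right (by positivity) hL
    linarith
  obtain ⟨χ, hx, hcyc⟩ := exists_local_cycle hM hn (half_pos hr)
    fun ε hε => exists_fine_reducing_map hr hfin hε
  obtain ⟨εA, hεA, hdeg1, hdeg2⟩ := χ.exists_deg_bd hx (ρ := r / 8) (by positivity)
  obtain ⟨ε₀, hε₀, T, hTid, hTbd, hT⟩ := exists_refinement hL hLLC (n + 2) (δ := 5 * δ)
    (by positivity) (by
      rw [le_div_iff₀ (by positivity)]
      have : 0 ≤ (F + 1) * L * δ := by positivity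
      linarith) hεA
  obtain ⟨z, hz, hbz, hdz⟩ := hcyc (min ε₀ (min η δ)) (by positivity)
  obtain ⟨E, hEbd, hE⟩ := exists_fine_prism (id : M → M) f
  have hd : ∀ A : Set M, ∀ a ∈ A, ∀ b ∈ A, dist a b ≤ min ε₀ (min η δ) →
      dist (id a) (id b) ≤ 5 * δ ∧ dist (id a) (f b) ≤ 5 * δ ∧ dist (f a) (f b) ≤ 5 * δ := by
    intro A a _ b _ hab
    have h0 : dist a b ≤ δ := hab.trans ((min_le_right _ _).trans (min_le_right _ _))
    have h1 := dist_triangle a b (f b)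
    have h2 := dist_triangle4 (f a) a b (f b)
    have h3 := hf a
    have h4 := hf b
    rw [dist_comm] at h4
    simp only [id]
    refine ⟨?_, ?_, ?_⟩ <;> linarith
  have hzE : E z ∈ fineChains (5 * δ) Set.univ (n + 2) :=
    hE _ _ _ Set.univ _ (fun _ _ => trivial) (fun _ _ => trivial) (hd _) _ hz
  have hpush : push f z = 0 := by
    refine map_eq (ψ := 0) (fun s hs => ?_) hz
    rw [push_simplex, if_neg, LinearMap.zero_apply]
    have h1 := hdim s (hs.2.1.trans ball_subset_closedBall) fun a ha b hb =>
      (hs.2.2 a ha b hb).trans ((min_le_right _ _).trans (min_le_left _ _))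
    have h2 := hs.1
    omega
  have hbE : E (bd z) ∈ fineChains (5 * δ) (ball x (r / 4 - 2 * δ))ᶜ (n + 1) := by
    refine hE _ _ (ball x (r / 2 / 2))ᶜ (ball x (r / 4 - 2 * δ))ᶜ _ (fun a ha h => ha (ball_subset_ball (by linarith) h))
      (fun a ha => notMem_ball_image hf (r' := r / 2 / 2) (by linarith) ha) (hd _) _ hbz
  have h1 := hdeg1 _ (hT (n + 1) (by omega) Set.univ Set.univ (fun _ _ _ _ => trivial) _ hzE le_rfl)
  rw [hTbd _ le_rfl _ hzE, hEbd, hpush, add_zero, push_eq_self (f := id) (fun _ _ _ _ => rfl) hz,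
    map_add, hTid _ z (fineChains_mono (min_le_left _ _) (Set.subset_univ _) hz), map_add, hdz,
    hdeg2 _ (hT n (by omega) (ball x (r / 4 - 2 * δ))ᶜ (ball x (r / 8))ᶜ (fun y a ha hya hy => ha ?_) _ hbE (by omega)),
    add_zero] at h1
  · exact one_ne_zero h1
  · have h2 := dist_triangle a y x
    rw [dist_comm a y] at h2
    rw [mem_ball] at hy ⊢
    nlinarith

end Volume

end FineChain

/-- **Corollary 1.5 (volume lower bound for balls).** There is `c > 0` depending only on
`n`, `D`, `L` such that for every closed, connected, `D`-doubling, `L`-linearly locally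
contractible metric `n`-manifold `M`, every `x ∈ M`, and every `0 < r ≤ diam M`, we have
`H_n(B(x,r)) ≥ c ⋅ rⁿ`. -/
theorem ball_volume_lower_bound (n D : ℕ) (L : ℝ) (hn : 1 ≤ n) (hD : 1 ≤ D) (hL : 1 ≤ L) :
    ∃ c : ℝ, 0 < c ∧
      ∀ (M : Type) [MetricSpace M] [CompactSpace M] [ConnectedSpace M]
        [MeasurableSpace M] [BorelSpace M],
        IsTopManifold n M → IsDoubling D M → IsLLC L M →
        ∀ (x : M) (r : ℝ), 0 < r → r ≤ diam (Set.univ : Set M) →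
          ENNReal.ofReal (c * r ^ n) ≤ μH[(n : ℝ)] (ball x r) := by
  obtain ⟨k, hk⟩ := pow_unbounded_of_one_lt
    (40 * (FineChain.fillRadius (4 * L + 1) (n + 2) + 1) * L) (one_lt_two (α := ℝ))
  refine ⟨(1 / 2 ^ k) ^ n / 2 ^ D ^ k, by positivity, ?_⟩
  intro M _ _ _ _ _ hM hdoub hLLC x r hr hrd
  classical
  by_contra! hlt
  obtain ⟨s, hs, hcov⟩ := FineChain.exists_iterated_cover_of_isDoubling hdoub x r k
  obtain ⟨p, hp⟩ := FineChain.exists_fin_centers hcov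
  have hsub : closedBall x (r / 2) ⊆ ball x r := closedBall_subset_ball (half_lt_self hr)
  have hδ : 0 < r / 2 ^ k := by positivity
  have hsmall : 2 ^ s.card * μH[(n : ℝ)] (ball x r) < ENNReal.ofReal ((r / 2 ^ k) ^ n) := by
    calc 2 ^ s.card * μH[(n : ℝ)] (ball x r) ≤ 2 ^ D ^ k * μH[(n : ℝ)] (ball x r) := by
          gcongr
          exact one_le_two
      _ < 2 ^ D ^ k * ENNReal.ofReal ((1 / 2 ^ k) ^ n / 2 ^ D ^ k * r ^ n) :=
          ENNReal.mul_lt_mul_right (by simp) (by simp) hlt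
      _ = ENNReal.ofReal (2 ^ D ^ k * ((1 / 2 ^ k) ^ n / 2 ^ D ^ k * r ^ n)) := by
          rw [ENNReal.ofReal_mul (p := 2 ^ D ^ k) (by positivity),
            ENNReal.ofReal_pow zero_le_two, ENNReal.ofReal_ofNat]
      _ = ENNReal.ofReal ((r / 2 ^ k) ^ n) := by
          rw [mul_comm, div_mul_eq_mul_div, div_mul_cancel₀ _ (by positivity), ← mul_pow,
            one_div_mul_eq_div]
  obtain ⟨f, hf, -, η, hη, hdim⟩ := FineChain.exists_reducing_map p (isCompact_closedBall x (r / 2))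
    hsub hδ hsmall fun y hy => hp y (hsub hy)
  refine FineChain.not_exists_coarse_reducing_map hn hL hM hLLC hr hrd hlt.ne_top hδ ?_ hf hη hdim
  rw [mul_div_assoc', div_le_iff₀ (by positivity)]
  nlinarith
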